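/- arXiv:2410.17678 — 8 statements merged into one kernel-verified Lean document; each statement's English description precedes it below -/
import Mathlib

section
/- For all integers k ≥ 2 and n ≥ m ≥ 1, the k-hyperopic cop number of the complete bipartite graph K_{m,n} equals m. -/
namespace CopsRobber

open SimpleGraph

/-- A strategy for `d` cops on vertex set `V`: initial positions, together with a move
function taking the list of observations made so far (most recent first; the observation in a
round is `some r` if the robber, located at `r`, was visible to the cops at the start of that
round, and `none` if he was invisible) and the current cop positions, and returning the cops'
new positions. -/
structure CopStrategy (V : Type) (d : ℕ) where
  init : Fin d → V
  move : List (Option V) → (Fin d → V) → Fin d → V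

/-- A strategy for the omniscient robber against `d` cops: a starting vertex chosen after
seeing the cops' initial positions, and a move function which may depend on the entire history
of the game (the list of past (cop positions, robber position) states, most recent first),
the cops' new positions, and the robber's current position. -/
structure RobberStrategy (V : Type) (d : ℕ) where
  init : (Fin d → V) → V
  move : List ((Fin d → V) × V) → (Fin d → V) → V → V

/-- A cop strategy is legal if every cop always stays put or moves along an edge of `G`. -/
def CopStrategy.Legal {V : Type} (G : SimpleGraph V) {d : ℕ} (S : CopStrategy V d) : Prop :=
  ∀ h p i, S.move h p i = p i ∨ G.Adj (p i) (S.move h p i)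

/-- A robber strategy is legal if the robber always stays put or moves along an edge of `G`. -/
def RobberStrategy.Legal {V : Type} (G : SimpleGraph V) {d : ℕ} (R : RobberStrategy V d) :
    Prop :=
  ∀ h c r, R.move h c r = r ∨ G.Adj r (R.move h c r)

open Classical in
/-- The cops' observation: the robber's position if he is visible, `none` otherwise. -/
noncomputable def observe {V : Type} {d : ℕ} (vis : (Fin d → V) → V → Prop)
    (c : Fin d → V) (r : V) : Option V :=
  if vis c r then some r else none

/-- The play of the game determined by a cop strategy and a robber strategy, with visibility
predicate `vis`: at each stage we record the current (cop positions, robber position) together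
with the list of past observations and the list of past states. In each round the cops observe
the robber (according to `vis`), move, and then the robber moves. -/
noncomputable def play {V : Type} {d : ℕ} (vis : (Fin d → V) → V → Prop)
    (S : CopStrategy V d) (R : RobberStrategy V d) :
    ℕ → ((Fin d → V) × V) × (List (Option V) × List ((Fin d → V) × V))
  | 0 => ((S.init, R.init S.init), ([], []))
  | n + 1 =>
    let st := play vis S R n
    let c := st.1.1
    let r := st.1.2
    let o := observe vis c r
    let c' := S.move (o :: st.2.1) c
    let r' := R.move ((c, r) :: st.2.2) c' r
    ((c', r'), (o :: st.2.1, (c, r) :: st.2.2))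

/-- The cops' positions at the end of round `n`. -/
noncomputable def copPos {V : Type} {d : ℕ} (vis : (Fin d → V) → V → Prop)
    (S : CopStrategy V d) (R : RobberStrategy V d) (n : ℕ) : Fin d → V :=
  (play vis S R n).1.1

/-- The robber's position at the end of round `n`. -/
noncomputable def robPos {V : Type} {d : ℕ} (vis : (Fin d → V) → V → Prop)
    (S : CopStrategy V d) (R : RobberStrategy V d) (n : ℕ) : V :=
  (play vis S R n).1.2

/-- The cops capture the robber in the given play: at some point (either at the end of a round,
or just after the cops' move within a round) some cop occupies the robber's vertex. -/
def Captures {V : Type} {d : ℕ} (vis : (Fin d → V) → V → Prop)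
    (S : CopStrategy V d) (R : RobberStrategy V d) : Prop :=
  ∃ n i, copPos vis S R n i = robPos vis S R n ∨ copPos vis S R (n + 1) i = robPos vis S R n

/-- A winning strategy for `d` cops on `G` with visibility predicate `vis`: a legal cop
strategy capturing the robber against every legal robber strategy (the robber is omniscient,
so the cops must succeed against all robber behaviours). -/
def WinningCopStrategy {V : Type} (G : SimpleGraph V) {d : ℕ}
    (vis : (Fin d → V) → V → Prop) (S : CopStrategy V d) : Prop :=
  S.Legal G ∧ ∀ R : RobberStrategy V d, R.Legal G → Captures vis S R

/-- The minimum number of cops having a winning strategy on `G`, for the game with visibility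
predicate `vis`. -/
noncomputable def copNumberVis {V : Type} (G : SimpleGraph V)
    (vis : ∀ d : ℕ, (Fin d → V) → V → Prop) : ℕ :=
  sInf {d | ∃ S : CopStrategy V d, WinningCopStrategy G (vis d) S}

/-- The classical cop number `c(G)`: the robber is always visible. -/
noncomputable def copNumber {V : Type} (G : SimpleGraph V) : ℕ :=
  copNumberVis G fun _ _ _ => True

/-- The 0-visibility cop number `c₀(G)`: the robber is never visible. -/
noncomputable def zeroVisCopNumber {V : Type} (G : SimpleGraph V) : ℕ :=
  copNumberVis G fun _ _ _ => False

/-- The `k`-hyperopic cop number `c_{H,k}(G)`: the robber at `r` is invisible exactly when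
every cop `c` satisfies `1 ≤ d(r,c) ≤ k`. -/
noncomputable def hyperopicCopNumber {V : Type} (G : SimpleGraph V) (k : ℕ) : ℕ :=
  copNumberVis G fun _ c r => ¬ ∀ i, 1 ≤ G.dist r (c i) ∧ G.dist r (c i) ≤ k

section Play

variable {V : Type} {d : ℕ} (vis : (Fin d → V) → V → Prop)
  (S : CopStrategy V d) (R : RobberStrategy V d)

lemma length_observations (n : ℕ) : (play vis S R n).2.1.length = n := by
  induction n with
  | zero => rfl
  | succ n ih => exact congrArg (· + 1) ih

lemma length_history (n : ℕ) : (play vis S R n).2.2.length = n := by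
  induction n with
  | zero => rfl
  | succ n ih => exact congrArg (· + 1) ih

lemma copPos_succ (n : ℕ) :
    copPos vis S R (n + 1) =
      S.move (observe vis (copPos vis S R n) (robPos vis S R n) :: (play vis S R n).2.1)
        (copPos vis S R n) := rfl

lemma robPos_succ (n : ℕ) :
    robPos vis S R (n + 1) =
      R.move ((copPos vis S R n, robPos vis S R n) :: (play vis S R n).2.2)
        (copPos vis S R (n + 1)) (robPos vis S R n) := rfl

variable {R} in
lemma robPos_succ_eq_or_adj {G : SimpleGraph V} (hR : R.Legal G) (n : ℕ) :
    robPos vis S R (n + 1) = robPos vis S R n ∨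
      G.Adj (robPos vis S R n) (robPos vis S R (n + 1)) :=
  hR _ _ _

end Play

/-- During one legal move, each cop visits at most one vertex of an independent set, so an
independent set larger than the number of cops contains an unvisited vertex. -/
lemma exists_unvisited {V : Type} {G : SimpleGraph V} {d : ℕ} (s : Finset V)
    (hs : ∀ a ∈ s, ∀ b ∈ s, ¬ G.Adj a b) (hd : d < s.card) {p q : Fin d → V}
    (hpq : ∀ i, q i = p i ∨ G.Adj (p i) (q i)) :
    ∃ v ∈ s, ∀ i, p i ≠ v ∧ q i ≠ v := by
  classical
  have hcard : (Finset.univ.image fun i => if p i ∈ s then p i else q i).card < s.card :=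
    (Finset.card_image_le.trans (by simp)).trans_lt hd
  obtain ⟨v, hv, hvi⟩ := Finset.exists_mem_notMem_of_card_lt_card hcard
  simp only [Finset.mem_image, Finset.mem_univ, true_and, not_exists] at hvi
  refine ⟨v, hv, fun i => ⟨fun h => hvi i ?_, fun h => hvi i ?_⟩⟩
  · rw [if_pos (h ▸ hv), h]
  · split_ifs with hp
    · rcases hpq i with hi | hi
      · rw [← hi, h]
      · exact absurd hi (hs _ hp _ (h ▸ hv))
    · exact h

open Classical in
/-- The robber who assumes that the cops never see him, and moves to a vertex visited neither
now nor during the next move of the cops. -/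
noncomputable def evader {V : Type} [Nonempty V] (G : SimpleGraph V) {d : ℕ}
    (S : CopStrategy V d) : RobberStrategy V d where
  init c := Classical.epsilon fun v => ∀ i, c i ≠ v ∧ S.move [none] c i ≠ v
  move h c r :=
    if H : ∃ v, (v = r ∨ G.Adj r v) ∧
        ∀ i, c i ≠ v ∧ S.move (List.replicate (h.length + 1) none) c i ≠ v
    then H.choose else r

lemma evader_legal {V : Type} [Nonempty V] (G : SimpleGraph V) {d : ℕ} (S : CopStrategy V d) :
    (evader G S).Legal G := by
  intro h c r
  unfold evader
  dsimp only
  split_ifs with H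
  · exact H.choose_spec.1
  · exact Or.inl rfl

lemma evader_move_spec {V : Type} [Nonempty V] {G : SimpleGraph V} {d : ℕ}
    {S : CopStrategy V d} {h : List ((Fin d → V) × V)} {c : Fin d → V} {r : V}
    (H : ∃ v, (v = r ∨ G.Adj r v) ∧
      ∀ i, c i ≠ v ∧ S.move (List.replicate (h.length + 1) none) c i ≠ v) (i : Fin d) :
    c i ≠ (evader G S).move h c r ∧
      S.move (List.replicate (h.length + 1) none) c i ≠ (evader G S).move h c r := by
  unfold evader
  dsimp only
  rw [dif_pos H]
  exact H.choose_spec.2 i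

/-- If the robber is invisible whenever he is not caught, and can always reach a vertex that is
not visited during the next move of the cops, then the cops do not win. -/
lemma not_winning_of_exists_unvisited {V : Type} {G : SimpleGraph V} {d : ℕ}
    {vis : (Fin d → V) → V → Prop} (S : CopStrategy V d)
    (hvis : ∀ c r, (∀ i, c i ≠ r) → ¬ vis c r)
    (hinit : ∀ p q : Fin d → V, (∀ i, q i = p i ∨ G.Adj (p i) (q i)) →
      ∃ v, ∀ i, p i ≠ v ∧ q i ≠ v)
    (hmove : ∀ (p q : Fin d → V) (r : V), (∀ i, q i = p i ∨ G.Adj (p i) (q i)) →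
      (∀ i, p i ≠ r) → ∃ v, (v = r ∨ G.Adj r v) ∧ ∀ i, p i ≠ v ∧ q i ≠ v) :
    ¬ WinningCopStrategy G vis S := by
  rintro ⟨hS, hwin⟩
  have hex := hinit S.init _ (hS [none] S.init)
  have : Nonempty V := ⟨hex.choose⟩
  set R := evader G S
  have inv : ∀ n, (play vis S R n).2.1 = List.replicate n none ∧
      ∀ i, copPos vis S R n i ≠ robPos vis S R n ∧
        S.move (List.replicate (n + 1) none) (copPos vis S R n) i ≠ robPos vis S R n := by
    intro n
    induction n with
    | zero => exact ⟨rfl, Classical.epsilon_spec hex⟩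
    | succ n ih =>
      obtain ⟨hobs, hfree⟩ := ih
      have hnone : observe vis (copPos vis S R n) (robPos vis S R n) = none :=
        if_neg (hvis _ _ fun i => (hfree i).1)
      have hobs' : observe vis (copPos vis S R n) (robPos vis S R n) :: (play vis S R n).2.1 =
          List.replicate (n + 1) none := by
        rw [hnone, hobs, List.replicate_succ]
      refine ⟨hobs', ?_⟩
      have hcop : ∀ i, copPos vis S R (n + 1) i ≠ robPos vis S R n := by
        rw [copPos_succ, hobs']
        exact fun i => (hfree i).2
      have hlen : ((copPos vis S R n, robPos vis S R n) :: (play vis S R n).2.2).length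
          = n + 1 := congrArg (· + 1) (length_history vis S R n)
      have hspec := evader_move_spec
        (h := (copPos vis S R n, robPos vis S R n) :: (play vis S R n).2.2)
        (hmove _ _ _ (hS (List.replicate _ none) _) hcop)
      rw [hlen] at hspec
      exact hspec
  obtain ⟨n, i, h | h⟩ := hwin R (evader_legal G S)
  · exact ((inv n).2 i).1 h
  · have hnone : observe vis (copPos vis S R n) (robPos vis S R n) = none :=
      if_neg (hvis _ _ fun i => ((inv n).2 i).1)
    rw [copPos_succ, hnone, (inv n).1, ← List.replicate_succ] at h
    exact ((inv n).2 i).2 h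

section CompleteBipartite

variable {m n : ℕ}

lemma completeBipartiteGraph_dist (hm : 1 ≤ m) (hn : 1 ≤ n) {u v : Fin m ⊕ Fin n}
    (huv : u ≠ v) :
    1 ≤ (completeBipartiteGraph (Fin m) (Fin n)).dist u v ∧
      (completeBipartiteGraph (Fin m) (Fin n)).dist u v ≤ 2 := by
  have hwalk : ∃ p : (completeBipartiteGraph (Fin m) (Fin n)).Walk u v, p.length ≤ 2 := by
    by_cases hadj : (completeBipartiteGraph (Fin m) (Fin n)).Adj u v
    · exact ⟨.cons hadj .nil, by simp⟩
    · obtain ⟨w, hu, hv⟩ : ∃ w, (completeBipartiteGraph (Fin m) (Fin n)).Adj u w ∧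
          (completeBipartiteGraph (Fin m) (Fin n)).Adj w v := by
        rcases u with a | a <;> rcases v with b | b
        · exact ⟨.inr ⟨0, hn⟩, by simp, by simp⟩
        · simp at hadj
        · simp at hadj
        · exact ⟨.inl ⟨0, hm⟩, by simp, by simp⟩
      exact ⟨.cons hu (.cons hv .nil), by simp⟩
  obtain ⟨p, hp⟩ := hwalk
  exact ⟨p.reachable.pos_dist_of_ne huv, (dist_le p).trans hp⟩

lemma exists_unvisited_inl {d : ℕ} (hd : d < m) {p q : Fin d → Fin m ⊕ Fin n}
    (hpq : ∀ i, q i = p i ∨ (completeBipartiteGraph (Fin m) (Fin n)).Adj (p i) (q i)) :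
    ∃ a, ∀ i, p i ≠ Sum.inl a ∧ q i ≠ Sum.inl a := by
  obtain ⟨v, hv, h⟩ := exists_unvisited (Finset.univ.map .inl) (by simp) (by simpa) hpq
  obtain ⟨a, -, rfl⟩ := Finset.mem_map.1 hv
  exact ⟨a, h⟩

lemma exists_unvisited_inr {d : ℕ} (hd : d < n) {p q : Fin d → Fin m ⊕ Fin n}
    (hpq : ∀ i, q i = p i ∨ (completeBipartiteGraph (Fin m) (Fin n)).Adj (p i) (q i)) :
    ∃ b, ∀ i, p i ≠ Sum.inr b ∧ q i ≠ Sum.inr b := by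
  obtain ⟨v, hv, h⟩ := exists_unvisited (Finset.univ.map .inr) (by simp) (by simpa) hpq
  obtain ⟨b, -, rfl⟩ := Finset.mem_map.1 hv
  exact ⟨b, h⟩

lemma completeBipartiteGraph_not_winning {d : ℕ} (hdm : d < m) (hdn : d < n)
    {vis : (Fin d → Fin m ⊕ Fin n) → Fin m ⊕ Fin n → Prop}
    (hvis : ∀ c r, (∀ i, c i ≠ r) → ¬ vis c r) (S : CopStrategy (Fin m ⊕ Fin n) d) :
    ¬ WinningCopStrategy (completeBipartiteGraph (Fin m) (Fin n)) vis S := by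
  refine not_winning_of_exists_unvisited S hvis
    (fun p q hpq => ?_) (fun p q r hpq hr => ?_)
  · obtain ⟨a, ha⟩ := exists_unvisited_inl hdm hpq
    exact ⟨_, ha⟩
  · rcases r with x | y
    · obtain ⟨b, hb⟩ := exists_unvisited_inr hdn hpq
      exact ⟨_, Or.inr (by simp), hb⟩
    · obtain ⟨a, ha⟩ := exists_unvisited_inl hdm hpq
      exact ⟨_, Or.inr (by simp), ha⟩

/-- All cops start on the left side and stay there, except that cop `0` searches the right side
by visiting its vertices one after the other, returning home in between. -/
def sweep (hm : 0 < m) (hn : 0 < n) : CopStrategy (Fin m ⊕ Fin n) m where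
  init := Sum.inl
  move h p i :=
    if i = ⟨0, hm⟩ then
      (p i).elim (fun _ => Sum.inr ⟨h.length / 2 % n, Nat.mod_lt _ hn⟩) fun _ => Sum.inl i
    else p i

lemma sweep_legal (hm : 0 < m) (hn : 0 < n) :
    (sweep hm hn).Legal (completeBipartiteGraph (Fin m) (Fin n)) := by
  intro h p i
  unfold sweep
  dsimp only
  split_ifs
  · rcases p i with x | y <;> simp
  · exact Or.inl rfl

variable (hm : 0 < m) (hn : 0 < n) (vis : (Fin m → Fin m ⊕ Fin n) → Fin m ⊕ Fin n → Prop)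
  (R : RobberStrategy (Fin m ⊕ Fin n) m)

lemma copPos_sweep_odd_of_even {j : ℕ} (h : copPos vis (sweep hm hn) R (2 * j) = Sum.inl) :
    copPos vis (sweep hm hn) R (2 * j + 1) = fun i =>
      if i = ⟨0, hm⟩ then Sum.inr ⟨j % n, Nat.mod_lt _ hn⟩ else Sum.inl i := by
  funext i
  rw [copPos_succ, h]
  have hj : (2 * j + 1) / 2 = j := by omega
  simp [sweep, length_observations, hj]

lemma copPos_sweep_even (j : ℕ) : copPos vis (sweep hm hn) R (2 * j) = Sum.inl := by
  induction j with
  | zero => rfl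
  | succ j ih =>
    funext i
    rw [show 2 * (j + 1) = 2 * j + 1 + 1 by ring, copPos_succ,
      copPos_sweep_odd_of_even hm hn vis R ih]
    by_cases hi : i = ⟨0, hm⟩ <;> simp [sweep, hi]

lemma copPos_sweep_odd (j : ℕ) :
    copPos vis (sweep hm hn) R (2 * j + 1) = fun i =>
      if i = ⟨0, hm⟩ then Sum.inr ⟨j % n, Nat.mod_lt _ hn⟩ else Sum.inl i :=
  copPos_sweep_odd_of_even hm hn vis R (copPos_sweep_even hm hn vis R j)

lemma sweep_winning :
    WinningCopStrategy (completeBipartiteGraph (Fin m) (Fin n)) vis (sweep hm hn) := by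
  refine ⟨sweep_legal hm hn, fun R hR => ?_⟩
  by_contra hcap
  simp only [Captures, not_exists, not_or] at hcap
  have heven := copPos_sweep_even hm hn vis R
  have hright : ∀ j, ∃ b, robPos vis (sweep hm hn) R (2 * j) = Sum.inr b := by
    intro j
    rcases hr : robPos vis (sweep hm hn) R (2 * j) with x | y
    · exact absurd (by rw [heven, hr]) (hcap (2 * j) x).1
    · exact ⟨y, rfl⟩
  obtain ⟨b, hb⟩ := hright 0
  have hfixed : ∀ j, robPos vis (sweep hm hn) R (2 * j) = Sum.inr b := by
    intro j
    induction j with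
    | zero => exact hb
    | succ j ih =>
      have hodd : robPos vis (sweep hm hn) R (2 * j + 1) = Sum.inr b := by
        rcases hr : robPos vis (sweep hm hn) R (2 * j + 1) with x | y
        · refine absurd ?_ (hcap (2 * j + 1) x).2
          rw [show 2 * j + 1 + 1 = 2 * (j + 1) by ring, heven, hr]
        · have := robPos_succ_eq_or_adj vis (sweep hm hn) hR (2 * j)
          rw [ih, hr] at this
          simpa using this
      obtain ⟨c, hc⟩ := hright (j + 1)
      have := robPos_succ_eq_or_adj vis (sweep hm hn) hR (2 * j + 1)
      rw [show 2 * j + 1 + 1 = 2 * (j + 1) by ring, hodd, hc] at this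
      rw [hc]
      simpa using this
  refine (hcap (2 * b) ⟨0, hm⟩).2 ?_
  rw [copPos_sweep_odd, hfixed]
  simp [Nat.mod_eq_of_lt b.2]

end CompleteBipartite

/-- For all integers `k ≥ 2` and `n ≥ m ≥ 1`, the `k`-hyperopic cop number of the complete
bipartite graph `K_{m,n}` equals `m`. -/
theorem stmt2 (k m n : ℕ) (hk : 2 ≤ k) (hm : 1 ≤ m) (hmn : m ≤ n) :
    hyperopicCopNumber (completeBipartiteGraph (Fin m) (Fin n)) k = m := by
  have hn : 1 ≤ n := hm.trans hmn
  refine le_antisymm (Nat.sInf_le ⟨sweep hm hn, sweep_winning hm hn _⟩)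
    (le_csInf ⟨m, sweep hm hn, sweep_winning hm hn _⟩ ?_)
  rintro d ⟨S, hS⟩
  by_contra! hd
  refine completeBipartiteGraph_not_winning hd (hd.trans_le hmn) (fun c r hc => ?_) S hS
  refine not_not_intro fun i => ?_
  have := completeBipartiteGraph_dist hm hn (hc i).symm
  exact ⟨this.1, this.2.trans hk⟩

end CopsRobber
end

section
/- For all integers k ≥ 1 and n ≥ 1, the k-hyperopic cop number of the complete graph K_n equals ⌈n/2⌉. -/
namespace CopsRobber

open SimpleGraph

/-- On a complete graph every move is legal. -/
lemma eq_or_top_adj {V : Type} (a b : V) : b = a ∨ (⊤ : SimpleGraph V).Adj a b := by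
  by_cases h : b = a
  · exact Or.inl h
  · exact Or.inr ((top_adj a b).2 (Ne.symm h))

/-- At least half as many cops as vertices sweep a complete graph in one round, whatever the
visibility. -/
lemma exists_winningCopStrategy_top {n d : ℕ} (hdn : d ≤ n) (hnd : n ≤ 2 * d)
    (vis : (Fin d → Fin n) → Fin n → Prop) :
    ∃ S : CopStrategy (Fin n) d, WinningCopStrategy ⊤ vis S := by
  let S : CopStrategy (Fin n) d :=
    { init := fun i => Fin.castLE hdn i
      move := fun _ _ i => ⟨min (i + d) (n - 1), by have := i.isLt; omega⟩ }
  refine ⟨S, fun _ _ _ => eq_or_top_adj _ _, fun R _ => ?_⟩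
  have hr := (R.init S.init).isLt
  by_cases h : (R.init S.init : ℕ) < d
  · exact ⟨0, ⟨_, h⟩, Or.inl (Fin.ext rfl)⟩
  · refine ⟨0, ⟨(R.init S.init : ℕ) - d, by omega⟩, Or.inr (Fin.ext ?_)⟩
    change min ((R.init S.init : ℕ) - d + d) (n - 1) = (R.init S.init : ℕ)
    omega

/-- Two placements of `d` cops leave a vertex free when there are more than `2 * d` vertices. -/
lemma exists_forall_ne_and_ne {n d : ℕ} (h : 2 * d < n) (p q : Fin d → Fin n) :
    ∃ v, ∀ i, p i ≠ v ∧ q i ≠ v := by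
  have hns : ¬ Function.Surjective (Sum.elim p q) := fun hs => by
    have := Fintype.card_le_of_surjective _ hs
    simp at this
    omega
  simp only [Function.Surjective, not_forall, not_exists] at hns
  obtain ⟨v, hv⟩ := hns
  exact ⟨v, fun i => ⟨hv (Sum.inl i), hv (Sum.inr i)⟩⟩

/-- If the robber is invisible whenever no cop is on his vertex, then fewer than half as many cops
as vertices cannot win on a complete graph. -/
lemma not_winningCopStrategy_top {n d : ℕ} (h : 2 * d < n)
    {vis : (Fin d → Fin n) → Fin n → Prop} (hvis : ∀ c r, (∀ i, c i ≠ r) → ¬ vis c r)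
    (S : CopStrategy (Fin n) d) : ¬ WinningCopStrategy ⊤ vis S := by
  rintro ⟨-, hS⟩
  choose f hf using exists_forall_ne_and_ne h
  let R : RobberStrategy (Fin n) d :=
    { init := fun c => f c (S.move [none] c)
      move := fun l c _ => f c (S.move (List.replicate (l.length + 1) none) c) }
  have key : ∀ m, (play vis S R m).2.1 = List.replicate m none ∧
      (play vis S R m).2.2.length = m ∧
      (play vis S R m).1.2 = f (play vis S R m).1.1
        (S.move (List.replicate (m + 1) none) (play vis S R m).1.1) := by
    intro m
    induction m with
    | zero => exact ⟨rfl, rfl, rfl⟩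
    | succ m ih =>
      obtain ⟨hobs, hlen, hrob⟩ := ih
      have hnone : observe vis (play vis S R m).1.1 (play vis S R m).1.2 = none :=
        if_neg (hvis _ _ fun i => hrob ▸ (hf _ _ i).1)
      refine ⟨?_, ?_, ?_⟩
      · simp only [play, hnone, hobs, List.replicate_succ]
      · simp only [play, List.length_cons, hlen]
      · simp only [play, R, List.length_cons]
        rw [hlen]
  obtain ⟨m, i, hc⟩ := hS R fun _ _ _ => eq_or_top_adj _ _
  obtain ⟨hobs, -, hrob⟩ := key m
  have hfree := hf (play vis S R m).1.1
    (S.move (List.replicate (m + 1) none) (play vis S R m).1.1) i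
  rw [← hrob] at hfree
  rcases hc with hc | hc
  · exact hfree.1 hc
  · have hnone : observe vis (play vis S R m).1.1 (play vis S R m).1.2 = none :=
      if_neg (hvis _ _ fun j => hrob ▸ (hf _ _ j).1)
    refine hfree.2 (Eq.trans ?_ hc)
    simp only [copPos, play, hnone, hobs, List.replicate_succ]

/-- For all integers `k ≥ 1` and `n ≥ 1`, the `k`-hyperopic cop number of the complete graph
`Kₙ` equals `⌈n/2⌉`. -/
theorem stmt5 (k n : ℕ) (hk : 1 ≤ k) (hn : 1 ≤ n) :
    hyperopicCopNumber (⊤ : SimpleGraph (Fin n)) k = (n + 1) / 2 := by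
  have hwin := exists_winningCopStrategy_top (n := n) (d := (n + 1) / 2) (by omega) (by omega)
    fun c r => ¬ ∀ i, 1 ≤ (⊤ : SimpleGraph (Fin n)).dist r (c i) ∧
      (⊤ : SimpleGraph (Fin n)).dist r (c i) ≤ k
  refine le_antisymm (Nat.sInf_le hwin) (le_csInf ⟨_, hwin⟩ ?_)
  rintro d ⟨S, hS⟩
  by_contra hd
  refine not_winningCopStrategy_top (by omega) (fun c r hcr => not_not.2 fun i => ?_) S hS
  have hdist : (⊤ : SimpleGraph (Fin n)).dist r (c i) = 1 :=
    dist_eq_one_iff_adj.2 ((top_adj _ _).2 (hcr i).symm)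
  rw [hdist]
  exact ⟨le_rfl, hk⟩

end CopsRobber
end

section
/- Let G be a finite connected simple graph and let k ≥ 1 be an integer. If diam(G) ≥ 2k+1, then c_{H,k}(G) ≤ c(G) + 2. -/
namespace CopsRobber

open SimpleGraph

/-- The cop positions obtained by adding two further cops at `u` and `v`. -/
def withPair {V : Type} {d : ℕ} (u v : V) (c : Fin d → V) : Fin (d + 2) → V :=
  Fin.append c ![u, v]

/-- The strategy for `d + 2` cops in which the first `d` cops follow `S` and two further cops
stay forever at `u` and `v`. -/
def CopStrategy.addPair {V : Type} {d : ℕ} (S : CopStrategy V d) (u v : V) :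
    CopStrategy V (d + 2) where
  init := withPair u v S.init
  move h p := Fin.append (S.move h fun j => p (Fin.castAdd 2 j)) fun j => p (Fin.natAdd d j)

/-- The strategy against `d` cops that imitates `R`, pretending that two further cops stand at
`u` and `v`. -/
def RobberStrategy.forgetPair {V : Type} {d : ℕ} (R : RobberStrategy V (d + 2)) (u v : V) :
    RobberStrategy V d where
  init c := R.init (withPair u v c)
  move h c r := R.move (h.map fun s => (withPair u v s.1, s.2)) (withPair u v c) r

theorem CopStrategy.Legal.addPair {V : Type} {G : SimpleGraph V} {d : ℕ} {S : CopStrategy V d}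
    (hS : S.Legal G) (u v : V) : (S.addPair u v).Legal G := by
  intro h p i
  refine Fin.addCases (fun j => ?_) (fun j => ?_) i
  · simpa [CopStrategy.addPair] using hS h (fun j => p (Fin.castAdd 2 j)) j
  · simp [CopStrategy.addPair]

/-- If the robber is always visible thanks to the cops at `u` and `v`, then the game against
`S.addPair u v` reproduces the perfect-information game against `S`. -/
theorem play_addPair {V : Type} {d : ℕ} (vis : (Fin (d + 2) → V) → V → Prop) (u v : V)
    (hvis : ∀ c r, vis (withPair u v c) r) (S : CopStrategy V d)
    (R : RobberStrategy V (d + 2)) (n : ℕ) :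
    play vis (S.addPair u v) R n =
      let st := play (fun _ _ => True) S (R.forgetPair u v) n
      ((withPair u v st.1.1, st.1.2),
        (st.2.1, st.2.2.map fun s => (withPair u v s.1, s.2))) := by
  induction n with
  | zero => rfl
  | succ n ih =>
    have hmove : ∀ h c, (S.addPair u v).move h (withPair u v c) = withPair u v (S.move h c) := by
      intro h c
      simp [CopStrategy.addPair, withPair]
    simp [play, ih, observe, hvis, hmove, RobberStrategy.forgetPair]

/-- On a finite vertex set, one cop on every vertex captures the robber immediately. -/
theorem exists_winningCopStrategy {V : Type} [Fintype V] (G : SimpleGraph V)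
    (vis : ∀ d : ℕ, (Fin d → V) → V → Prop) :
    ∃ d, ∃ S : CopStrategy V d, WinningCopStrategy G (vis d) S := by
  refine ⟨Fintype.card V, ⟨(Fintype.equivFin V).symm, fun _ p => p⟩,
    fun _ _ _ => Or.inl rfl,
    fun R _ => ⟨0, Fintype.equivFin V (R.init (Fintype.equivFin V).symm), Or.inl ?_⟩⟩
  exact (Fintype.equivFin V).symm_apply_apply _

theorem WinningCopStrategy.addPair {V : Type} {G : SimpleGraph V} {d : ℕ} {S : CopStrategy V d}
    (hS : WinningCopStrategy G (fun _ _ => True) S) (vis : (Fin (d + 2) → V) → V → Prop)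
    (u v : V) (hvis : ∀ c r, vis (withPair u v c) r) :
    WinningCopStrategy G vis (S.addPair u v) := by
  refine ⟨hS.1.addPair u v, fun R hR => ?_⟩
  obtain ⟨n, i, h⟩ := hS.2 (R.forgetPair u v) fun h c r => hR _ _ r
  refine ⟨n, Fin.castAdd 2 i, ?_⟩
  simpa only [copPos, robPos, play_addPair vis u v hvis, withPair, Fin.append_left] using h

/-- If `G` is a finite connected simple graph, `k ≥ 1` and `diam(G) ≥ 2k + 1`, then
`c_{H,k}(G) ≤ c(G) + 2`. -/
theorem stmt6 {V : Type} [Fintype V] (G : SimpleGraph V) (hG : G.Connected)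
    (k : ℕ) (hk : 1 ≤ k) (hdiam : 2 * k + 1 ≤ G.diam) :
    hyperopicCopNumber G k ≤ copNumber G + 2 := by
  have := hG.nonempty
  obtain ⟨S, hS⟩ := Nat.sInf_mem (exists_winningCopStrategy G fun _ _ _ => True)
  obtain ⟨u, v, huv⟩ := G.exists_dist_eq_diam
  refine Nat.sInf_le ⟨S.addPair u v, hS.addPair _ u v fun c r h => ?_⟩
  have hu : G.dist r u ≤ k :=
    (congrArg (G.dist r) (Fin.append_right c ![u, v] 0)).symm.trans_le (h _).2
  have hv : G.dist r v ≤ k :=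
    (congrArg (G.dist r) (Fin.append_right c ![u, v] 1)).symm.trans_le (h _).2
  have htri := hG.dist_triangle (u := u) (v := r) (w := v)
  rw [G.dist_comm (u := u) (v := r)] at htri
  omega

end CopsRobber
end

section
/- Let k ≥ 2 be an integer and let G be a finite connected simple graph. Then c_{H,k}(G) = 1 if and only if G is a caterpillar. -/
namespace CopsRobber

open SimpleGraph

/-- A vertex is a leaf if it has exactly one neighbour. -/
def IsLeaf {V : Type} (G : SimpleGraph V) (v : V) : Prop :=
  ∃! w, G.Adj v w

/-- A caterpillar: a tree such that removing all of its leaves yields a (possibly empty)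
path. -/
def IsCaterpillar {V : Type} (G : SimpleGraph V) : Prop :=
  G.IsTree ∧
    ∃ n : ℕ, Nonempty ((G.induce {v : V | ¬ IsLeaf G v}) ≃g SimpleGraph.pathGraph n)

section SingleCopGame

variable {V : Type} {G : SimpleGraph V}

/-- A lazy walk stays put or moves along an edge at every step. -/
def LazyWalk (G : SimpleGraph V) (w : ℕ → V) : Prop :=
  ∀ t, w (t + 1) = w t ∨ G.Adj (w t) (w (t + 1))

section SingleCop

/-- If `f` evades the lazy walk `w` of the cop while staying invisible, a robber who knows `w`
follows `f`. -/
theorem not_winning_of_evasion (hG : G.Connected) {k : ℕ} (hk : 2 ≤ k)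
    (hev : ∀ w : ℕ → V, LazyWalk G w → ∃ f : ℕ → V, LazyWalk G f ∧
      ∀ t, f t ≠ w t ∧ f t ≠ w (t + 1) ∧ G.dist (f t) (w t) ≤ 2)
    (S : CopStrategy V 1) :
    ¬ WinningCopStrategy G (fun c r => ¬ ∀ i, 1 ≤ G.dist r (c i) ∧ G.dist r (c i) ≤ k) S := by
  classical
  rintro ⟨hlegal, hcap⟩
  set vis : (Fin 1 → V) → V → Prop :=
    fun c r => ¬ ∀ i, 1 ≤ G.dist r (c i) ∧ G.dist r (c i) ≤ k with hvis
  let c : ℕ → Fin 1 → V := fun n =>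
    Nat.rec S.init (fun n p => S.move (List.replicate (n + 1) none) p) n
  have hc : ∀ n, c (n + 1) = S.move (List.replicate (n + 1) none) (c n) := fun n => rfl
  obtain ⟨f, hf, hfc⟩ := hev (fun n => c n 0) fun n => by
    simpa only [hc] using hlegal (List.replicate (n + 1) none) (c n) 0
  let R : RobberStrategy V 1 :=
    { init := fun _ => f 0
      move := fun h _ r => if r = f (h.length - 1) then f h.length else r }
  have hR : R.Legal G := by
    intro h p r
    simp only [R]
    split_ifs with hr
    · rcases h with _ | ⟨s, h⟩
      · left; simpa using hr.symm
      · subst hr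
        simpa using hf h.length
    · exact Or.inl rfl
  have hinv : ∀ n, ¬ vis (c n) (f n) := by
    intro n
    rw [hvis, not_not]
    intro i
    obtain ⟨h1, -, h2⟩ := hfc n
    obtain rfl : i = 0 := Subsingleton.elim _ _
    exact ⟨hG.pos_dist_of_ne h1, h2.trans hk⟩
  have hplay : ∀ n, (play vis S R n).1 = (c n, f n) ∧
      (play vis S R n).2.1 = List.replicate n none ∧ (play vis S R n).2.2.length = n := by
    intro n
    induction n with
    | zero => exact ⟨rfl, rfl, rfl⟩
    | succ n ih =>
      obtain ⟨h1, h2, h3⟩ := ih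
      have ho : observe vis (c n) (f n) = none := if_neg (hinv n)
      simp only [play, h1, h2, ho, hc, R, h3, List.length_cons, List.replicate_succ]
      simp
  obtain ⟨n, i, h⟩ := hcap R hR
  obtain rfl : i = 0 := Subsingleton.elim _ _
  simp only [copPos, robPos, (hplay _).1] at h
  exact h.elim (fun h => (hfc n).1 h.symm) fun h => (hfc n).2.1 h.symm

/-- A lazy walk that no robber evades for `T` rounds is a winning strategy for one cop. -/
theorem exists_winning_of_lazyWalk (vis : (Fin 1 → V) → V → Prop) {w : ℕ → V}
    (hw : LazyWalk G w) (T : ℕ)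
    (hcatch : ∀ f : ℕ → V, LazyWalk G f → ∃ t ≤ T, f t = w t ∨ f t = w (t + 1)) :
    ∃ S : CopStrategy V 1, WinningCopStrategy G vis S := by
  classical
  let S : CopStrategy V 1 :=
    { init := fun _ => w 0
      move := fun h p i => if p i = w (h.length - 1) then w h.length else p i }
  have hS : S.Legal G := by
    intro h p i
    simp only [S]
    split_ifs with hp
    · rcases h with _ | ⟨o, h⟩
      · left; simpa using hp.symm
      · rw [hp]
        simpa using hw h.length
    · exact Or.inl rfl
  refine ⟨S, hS, fun R hR => ?_⟩
  have hplay : ∀ n, (play vis S R n).1.1 = (fun _ => w n) ∧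
      (play vis S R n).2.1.length = n := by
    intro n
    induction n with
    | zero => exact ⟨rfl, rfl⟩
    | succ n ih =>
      obtain ⟨h1, h2⟩ := ih
      simp [play, h1, h2, S]
  obtain ⟨t, -, ht⟩ := hcatch (robPos vis S R) fun n => hR _ _ _
  refine ⟨t, 0, ?_⟩
  simp only [copPos, (hplay _).1]
  exact ht.imp Eq.symm Eq.symm

theorem hyperopicCopNumber_eq_one_iff [Nonempty V] (k : ℕ) :
    hyperopicCopNumber G k = 1 ↔ ∃ S : CopStrategy V 1,
      WinningCopStrategy G (fun c r => ¬ ∀ i, 1 ≤ G.dist r (c i) ∧ G.dist r (c i) ≤ k) S := by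
  have h0 : ∀ vis, ¬ ∃ S : CopStrategy V 0, WinningCopStrategy G vis S := by
    rintro vis ⟨S, -, hS⟩
    obtain ⟨v⟩ := ‹Nonempty V›
    obtain ⟨n, i, -⟩ := hS ⟨fun _ => v, fun _ _ r => r⟩ fun _ _ _ => Or.inl rfl
    exact i.elim0
  unfold hyperopicCopNumber copNumberVis
  constructor
  · intro h
    have := Nat.sInf_mem (Nat.nonempty_of_pos_sInf (h ▸ Nat.one_pos))
    rwa [h] at this
  · intro h
    refine le_antisymm (Nat.sInf_le h) (Nat.one_le_iff_ne_zero.2 fun h' => ?_)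
    rcases Nat.sInf_eq_zero.1 h' with h' | h'
    · exact h0 _ h'
    · exact Set.eq_empty_iff_forall_notMem.1 h' 1 h

end SingleCop

section Robber

/-- Every vertex of `R'` can be reached in one robber move from a vertex of `R` that the cop,
having moved to `u`, does not occupy. -/
def Escapes (G : SimpleGraph V) (R : Set V) (u : V) (R' : Set V) : Prop :=
  ∀ x ∈ R', ∃ y ∈ R, y ≠ u ∧ (x = y ∨ G.Adj y x)

/-- A family `I` of pairs (cop position, nonempty set of possible invisible robber positions)
which the robber can maintain against every cop move. -/
structure IsEvasion (G : SimpleGraph V) (I : V → Set V → Prop) : Prop where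
  start : ∃ v R, I v R
  nonempty : ∀ {v R}, I v R → R.Nonempty
  near : ∀ {v R}, I v R → ∀ x ∈ R, x ≠ v ∧ G.dist x v ≤ 2
  stay : ∀ {v R}, I v R → Escapes G R v R
  step : ∀ {v R u}, I v R → G.Adj v u → ∃ R', I u R' ∧ Escapes G R u R'

theorem IsEvasion.exists_of_connected {I : V → Set V → Prop} (hI : IsEvasion G I)
    (hG : G.Connected) (u : V) : ∃ R, I u R := by
  obtain ⟨v, hv⟩ := hI.start
  obtain ⟨p⟩ := hG.preconnected v u
  induction p with
  | nil => exact hv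
  | cons h _ ih =>
    obtain ⟨R, hR⟩ := hv
    obtain ⟨R', hR', -⟩ := hI.step hR h
    exact ih ⟨R', hR'⟩

/-- Kőnig's lemma for sequences in a finite type. -/
theorem exists_seq_of_forall_exists_finite_seq [Finite V] {P : ℕ → V → V → Prop}
    (h : ∀ T, ∃ f : ℕ → V, ∀ t < T, P t (f t) (f (t + 1))) :
    ∃ f : ℕ → V, ∀ t, P t (f t) (f (t + 1)) := by
  let _ : TopologicalSpace V := ⊥
  have : DiscreteTopology V := ⟨rfl⟩
  let K : ℕ → Set (ℕ → V) := fun T => {f | ∀ t < T, P t (f t) (f (t + 1))}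
  have hcl : ∀ T, IsClosed (K T) := by
    intro T
    have : K T = ⋂ t, ⋂ (_ : t < T), (fun f : ℕ → V => (f t, f (t + 1))) ⁻¹'
        {q | P t q.1 q.2} := by
      ext f; simp [K]
    rw [this]
    exact isClosed_iInter fun t => isClosed_iInter fun _ =>
      (isClosed_discrete _).preimage (by fun_prop)
  obtain ⟨f, hf⟩ := IsCompact.nonempty_iInter_of_sequence_nonempty_isCompact_isClosed K
    (fun T f hf t ht => hf t (ht.trans (Nat.lt_succ_self T))) h (hcl 0).isCompact hcl
  exact ⟨f, fun t => Set.mem_iInter.1 hf (t + 1) t (Nat.lt_succ_self t)⟩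

theorem IsEvasion.exists_evading [Finite V] {I : V → Set V → Prop} (hI : IsEvasion G I)
    (hG : G.Connected) {w : ℕ → V} (hw : LazyWalk G w) :
    ∃ f : ℕ → V, LazyWalk G f ∧
      ∀ t, f t ≠ w t ∧ f t ≠ w (t + 1) ∧ G.dist (f t) (w t) ≤ 2 := by
  have hnext : ∀ t (R : {R // I (w t) R}), ∃ R' : {R // I (w (t + 1)) R},
      Escapes G R.1 (w (t + 1)) R'.1 := by
    rintro t ⟨R, hR⟩
    rcases hw t with h | h
    · rw [h]
      exact ⟨⟨R, hR⟩, hI.stay hR⟩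
    · obtain ⟨R', hR', hE⟩ := hI.step hR h
      exact ⟨⟨R', hR'⟩, hE⟩
  choose F hF using hnext
  obtain ⟨R₀, hR₀⟩ := hI.exists_of_connected hG (w 0)
  let R : ∀ t, {R // I (w t) R} := fun t =>
    Nat.rec (motive := fun t => {R // I (w t) R}) ⟨R₀, hR₀⟩ F t
  have hR : ∀ t, Escapes G (R t).1 (w (t + 1)) (R (t + 1)).1 := fun t => hF t (R t)
  have hfin : ∀ T, ∀ x ∈ (R T).1, ∃ f : ℕ → V, f T = x ∧ ∀ t < T, f t ∈ (R t).1 ∧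
      f t ≠ w (t + 1) ∧ (f (t + 1) = f t ∨ G.Adj (f t) (f (t + 1))) := by
    intro T
    induction T with
    | zero => exact fun x _ => ⟨fun _ => x, rfl, by simp⟩
    | succ T ih =>
      intro x hx
      obtain ⟨y, hy, hyw, hyx⟩ := hR T x hx
      obtain ⟨f, rfl, hf⟩ := ih y hy
      refine ⟨fun t => if t ≤ T then f t else x, by simp, fun t ht => ?_⟩
      rcases Nat.lt_succ_iff_lt_or_eq.1 ht with ht | rfl
      · simpa [ht.le, Nat.succ_le_of_lt ht] using hf t ht
      · simpa using ⟨hy, hyw, hyx⟩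
  obtain ⟨f, hf⟩ := exists_seq_of_forall_exists_finite_seq (V := V)
    (P := fun t x y => x ∈ (R t).1 ∧ x ≠ w (t + 1) ∧ (y = x ∨ G.Adj x y)) fun T => by
      obtain ⟨x, hx⟩ := hI.nonempty (R T).2
      obtain ⟨f, -, hf⟩ := hfin T x hx
      exact ⟨f, hf⟩
  exact ⟨f, fun t => (hf t).2.2, fun t =>
    ⟨(hI.near (R t).2 _ (hf t).1).1, (hf t).2.1, (hI.near (R t).2 _ (hf t).1).2⟩⟩

theorem IsEvasion.not_winning [Finite V] {I : V → Set V → Prop} (hI : IsEvasion G I)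
    (hG : G.Connected) {k : ℕ} (hk : 2 ≤ k) (S : CopStrategy V 1) :
    ¬ WinningCopStrategy G (fun c r => ¬ ∀ i, 1 ≤ G.dist r (c i) ∧ G.dist r (c i) ≤ k) S :=
  not_winning_of_evasion hG hk (fun _ hw => hI.exists_evading hG hw) S

/-- `Leads G D v p` holds if some non-backtracking walk starts with the step from `v` to `p` and
ends with a step in `D`. -/
inductive Leads (G : SimpleGraph V) (D : V → V → Prop) : V → V → Prop
  | base {v p : V} : D v p → Leads G D v p
  | cons {u v p : V} : G.Adj u v → u ≠ p → Leads G D v p → Leads G D u v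

theorem Leads.adj {D : V → V → Prop} (hD : ∀ v p, D v p → G.Adj v p) {v p : V}
    (h : Leads G D v p) : G.Adj v p := by
  cases h with
  | base h => exact hD _ _ h
  | cons h _ _ => exact h

theorem dist_le_two_of_adj_adj {x m v : V} (h₁ : G.Adj x m) (h₂ : G.Adj m v) :
    G.dist x v ≤ 2 :=
  SimpleGraph.dist_le (.cons h₁ (.cons h₂ .nil))

theorem dist_le_two_of_adj {x v : V} (h : G.Adj x v) : G.dist x v ≤ 2 :=
  (SimpleGraph.dist_le (.cons h .nil)).trans (by simp)

theorem escapes_self {R : Set V} {v : V} (h : ∀ x ∈ R, x ≠ v) : Escapes G R v R :=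
  fun x hx => ⟨x, hx, h x hx, Or.inl rfl⟩

/-- The robber positions while the cop is at `v`: the next two vertices `p` and `q` of a
non-backtracking walk leading to `D`. -/
def Trail (G : SimpleGraph V) (D : V → V → Prop) (v : V) (R : Set V) : Prop :=
  ∃ p q, G.Adj v p ∧ Leads G D p q ∧ q ≠ v ∧ R = {p, q}

theorem Trail.near {D : V → V → Prop} (hD : ∀ v p, D v p → G.Adj v p) {v : V} {R : Set V}
    (h : Trail G D v R) : ∀ x ∈ R, x ≠ v ∧ G.dist x v ≤ 2 := by
  obtain ⟨p, q, hvp, hpq, hqv, rfl⟩ := h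
  rintro x (rfl | rfl)
  · exact ⟨hvp.ne', dist_le_two_of_adj hvp.symm⟩
  · exact ⟨hqv, dist_le_two_of_adj_adj (hpq.adj hD).symm hvp.symm⟩

/-- Either the cop's move leaves the robber on a trail, or the cop has reached `D`. -/
theorem Trail.step {D : V → V → Prop} (hD : ∀ v p, D v p → G.Adj v p) {v u : V} {R : Set V}
    (h : Trail G D v R) (hvu : G.Adj v u) :
    (∃ R', Trail G D u R' ∧ Escapes G R u R') ∨ ∃ q ∈ R, D u q := by
  obtain ⟨p, q, hvp, hpq, hqv, rfl⟩ := h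
  by_cases hup : u = p
  · subst hup
    cases hpq with
    | base h => exact Or.inr ⟨q, by simp, h⟩
    | @cons _ _ q' huq huq' hqq' =>
      refine Or.inl ⟨{q, q'}, ⟨q, q', huq, hqq', huq'.symm, rfl⟩, ?_⟩
      rintro x (rfl | rfl)
      · exact ⟨_, by simp, huq.ne', Or.inl rfl⟩
      · exact ⟨q, by simp, huq.ne', Or.inr (hqq'.adj hD)⟩
  · refine Or.inl ⟨{v, p}, ⟨v, p, hvu.symm, hpq.cons hvp hqv.symm, Ne.symm hup, rfl⟩, ?_⟩
    rintro x (rfl | rfl)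
    · exact ⟨p, by simp, Ne.symm hup, Or.inr hvp.symm⟩
    · exact ⟨_, by simp, Ne.symm hup, Or.inl rfl⟩

theorem isEvasion_of_forall_exists {D : V → V → Prop} (hD : ∀ v p, D v p → G.Adj v p)
    (hne : ∃ v p, D v p) (hext : ∀ v p, D v p → ∃ q, q ≠ v ∧ D p q) :
    IsEvasion G (Trail G D) where
  start := by
    obtain ⟨v, p, h⟩ := hne
    obtain ⟨q, hqv, hpq⟩ := hext v p h
    exact ⟨v, _, p, q, hD _ _ h, .base hpq, hqv, rfl⟩
  nonempty := by
    rintro v _ ⟨p, q, -, -, -, rfl⟩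
    exact ⟨p, by simp⟩
  near h := h.near hD
  stay h := escapes_self fun x hx => (h.near hD x hx).1
  step := by
    intro v R u h hvu
    refine (h.step hD hvu).elim id ?_
    rintro ⟨q, hq, huq⟩
    obtain ⟨q', hq', hqq'⟩ := hext u q huq
    have hqu := (hD u q huq).ne'
    refine ⟨{q, q'}, ⟨q, q', hD _ _ huq, .base hqq', hq', rfl⟩, ?_⟩
    rintro x (rfl | rfl)
    · exact ⟨_, hq, hqu, Or.inl rfl⟩
    · exact ⟨q, hq, hqu, Or.inr (hD _ _ hqq')⟩

theorem isAcyclic_of_winning [Finite V] (hG : G.Connected) {k : ℕ} (hk : 2 ≤ k)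
    {S : CopStrategy V 1} (hS : WinningCopStrategy G
      (fun c r => ¬ ∀ i, 1 ≤ G.dist r (c i) ∧ G.dist r (c i) ≤ k) S) : G.IsAcyclic := by
  intro v c hc
  refine (isEvasion_of_forall_exists (G := G) (D := c.toSubgraph.Adj)
    (fun v p h => h.adj_sub) ?_ ?_).not_winning hG hk S hS
  · have h2 := hc.ncard_neighborSet_toSubgraph_eq_two c.start_mem_support
    obtain ⟨p, hp⟩ := Set.nonempty_of_ncard_ne_zero (by rw [h2]; decide)
    exact ⟨v, p, hp⟩
  · intro u p hup
    have h2 := hc.ncard_neighborSet_toSubgraph_eq_two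
      (c.mem_verts_toSubgraph.1 (c.toSubgraph.edge_vert hup.symm))
    obtain ⟨q, hq, hqu⟩ := Set.exists_ne_of_one_lt_ncard (by rw [h2]; decide) u
    exact ⟨q, hqu, hq⟩

/-- The robber positions that he maintains around a vertex `a` with neighbours `b 0`, `b 1`,
`b 2`, each `b i` having another neighbour `c i`. -/
inductive SpiderEvasion (G : SimpleGraph V) (a : V) (b c : Fin 3 → V) : V → Set V → Prop
  | center {i j : Fin 3} : i ≠ j → SpiderEvasion G a b c a {b i, c i, b j, c j}
  | beside {v : V} {i j : Fin 3} : G.Adj v a → i ≠ j → b i ≠ v → b j ≠ v →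
      SpiderEvasion G a b c v {a, b i, b j}
  | leg {i j : Fin 3} : i ≠ j → SpiderEvasion G a b c (b i) {c i, a, b j}
  | far {v : V} {R : Set V} : Trail G (fun v p => G.Adj v p ∧ p = a) v R →
      SpiderEvasion G a b c v R

theorem isEvasion_spider {a : V} {b c : Fin 3 → V} (hb : Function.Injective b)
    (hab : ∀ i, G.Adj a (b i)) (hbc : ∀ i, G.Adj (b i) (c i)) (hca : ∀ i, c i ≠ a) :
    IsEvasion G (SpiderEvasion G a b c) := by
  have hD : ∀ v p, G.Adj v p ∧ p = a → G.Adj v p := fun _ _ h => h.1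
  have hnear : ∀ {v R}, SpiderEvasion G a b c v R → ∀ x ∈ R, x ≠ v ∧ G.dist x v ≤ 2 := by
    intro v R h
    cases h with
    | center hij =>
      rintro x (rfl | rfl | rfl | rfl)
      · exact ⟨(hab _).ne', dist_le_two_of_adj (hab _).symm⟩
      · exact ⟨hca _, dist_le_two_of_adj_adj (hbc _).symm (hab _).symm⟩
      · exact ⟨(hab _).ne', dist_le_two_of_adj (hab _).symm⟩
      · exact ⟨hca _, dist_le_two_of_adj_adj (hbc _).symm (hab _).symm⟩
    | beside hva _ hi hj =>
      rintro x (rfl | rfl | rfl)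
      · exact ⟨hva.ne', dist_le_two_of_adj hva.symm⟩
      · exact ⟨hi, dist_le_two_of_adj_adj (hab _).symm hva.symm⟩
      · exact ⟨hj, dist_le_two_of_adj_adj (hab _).symm hva.symm⟩
    | leg hij =>
      rintro x (rfl | rfl | rfl)
      · exact ⟨(hbc _).ne', dist_le_two_of_adj (hbc _).symm⟩
      · exact ⟨(hab _).ne, dist_le_two_of_adj (hab _)⟩
      · exact ⟨hb.ne hij.symm, dist_le_two_of_adj_adj (hab _).symm (hab _)⟩
    | far h => exact h.near hD
  have htrail : ∀ {v u : V} {R : Set V}, G.Adj v a → G.Adj v u → u ≠ a → a ∈ R →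
      ∃ R', SpiderEvasion G a b c u R' ∧ Escapes G R u R' := by
    intro v u R hva hvu hua haR
    refine ⟨{v, a}, .far ⟨v, a, hvu.symm, .base ⟨hva, rfl⟩, hua.symm, rfl⟩, ?_⟩
    rintro x (rfl | rfl)
    · exact ⟨a, haR, hua.symm, Or.inr hva.symm⟩
    · exact ⟨_, haR, hua.symm, Or.inl rfl⟩
  have hlegs : ∀ u, ∃ i j, i ≠ j ∧ b i ≠ u ∧ b j ≠ u := by
    intro u
    by_cases h0 : b 0 = u
    · exact ⟨1, 2, by decide, h0 ▸ hb.ne (by decide), h0 ▸ hb.ne (by decide)⟩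
    by_cases h1 : b 1 = u
    · exact ⟨0, 2, by decide, h0, h1 ▸ hb.ne (by decide)⟩
    · exact ⟨0, 1, by decide, h0, h1⟩
  have hleg : ∀ {i j : Fin 3} {R : Set V}, i ≠ j → c i ∈ R → b j ∈ R →
      ∃ R', SpiderEvasion G a b c (b i) R' ∧ Escapes G R (b i) R' := by
    intro i j R hij hi hj
    refine ⟨_, .leg hij, ?_⟩
    rintro x (rfl | rfl | rfl)
    · exact ⟨_, hi, (hbc i).ne', Or.inl rfl⟩
    · exact ⟨_, hj, hb.ne hij.symm, Or.inr (hab j).symm⟩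
    · exact ⟨_, hj, hb.ne hij.symm, Or.inl rfl⟩
  refine ⟨⟨a, _, .center (i := 0) (j := 1) (by decide)⟩, ?_, hnear,
    fun h => escapes_self fun x hx => (hnear h x hx).1, ?_⟩
  · rintro v R (_ | _ | _ | ⟨p, q, -, -, -, rfl⟩) <;> simp
  intro v R u h hvu
  cases h with
  | @center i j hij =>
    by_cases hi : b i = u
    · exact hi ▸ hleg hij (by simp) (by simp)
    by_cases hj : b j = u
    · exact hj ▸ hleg hij.symm (by simp) (by simp)
    refine ⟨_, .beside hvu.symm hij hi hj, ?_⟩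
    rintro x (rfl | rfl | rfl)
    · exact ⟨b i, by simp, hi, Or.inr (hab i).symm⟩
    · exact ⟨_, by simp, hi, Or.inl rfl⟩
    · exact ⟨_, by simp, hj, Or.inl rfl⟩
  | @beside _ i j hva hij hi hj =>
    by_cases hua : u = a
    · subst hua
      refine ⟨_, .center hij, ?_⟩
      rintro x (rfl | rfl | rfl | rfl)
      · exact ⟨b i, by simp, (hab _).ne', Or.inl rfl⟩
      · exact ⟨b i, by simp, (hab _).ne', Or.inr (hbc _)⟩
      · exact ⟨b j, by simp, (hab _).ne', Or.inl rfl⟩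
      · exact ⟨b j, by simp, (hab _).ne', Or.inr (hbc _)⟩
    · exact htrail hva hvu hua (by simp)
  | @leg i j hij =>
    by_cases hua : u = a
    · subst hua
      refine ⟨_, .center hij, ?_⟩
      rintro x (rfl | rfl | rfl | rfl)
      · exact ⟨c i, by simp, hca _, Or.inr (hbc _).symm⟩
      · exact ⟨c i, by simp, hca _, Or.inl rfl⟩
      · exact ⟨b j, by simp, (hab _).ne', Or.inl rfl⟩
      · exact ⟨b j, by simp, (hab _).ne', Or.inr (hbc _)⟩
    · exact htrail (hab i).symm hvu hua (by simp)
  | far h =>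
    rcases h.step hD hvu with ⟨R', hR', hE⟩ | ⟨q, hq, hua, rfl⟩
    · exact ⟨R', .far hR', hE⟩
    · obtain ⟨i, j, hij, hi, hj⟩ := hlegs u
      refine ⟨_, .beside hua hij hi hj, ?_⟩
      rintro x (rfl | rfl | rfl)
      · exact ⟨_, hq, hua.ne', Or.inl rfl⟩
      · exact ⟨q, hq, hua.ne', Or.inr (hab _)⟩
      · exact ⟨q, hq, hua.ne', Or.inr (hab _)⟩

end Robber

section Spine

theorem exists_adj_ne_of_not_isLeaf {v a : V} (hv : ¬ IsLeaf G v) (hva : G.Adj v a) :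
    ∃ c, G.Adj v c ∧ c ≠ a := by
  by_contra! h
  exact hv ⟨a, hva, h⟩

/-- A set of vertices closed under adjacency in a connected graph is everything. -/
theorem forall_mem_of_adj_closed (hG : G.Connected) {s : Set V} {v : V} (hv : v ∈ s)
    (h : ∀ x ∈ s, ∀ y, G.Adj x y → y ∈ s) (u : V) : u ∈ s := by
  obtain ⟨p⟩ := hG.preconnected v u
  induction p with
  | nil => exact hv
  | cons hadj _ ih => exact ih (h _ hv _ hadj)

theorem isCaterpillar_of_forall_not_spider [Finite V] (hG : G.Connected) (hacyc : G.IsAcyclic)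
    (hspider : ∀ a x y z, G.Adj a x → G.Adj a y → G.Adj a z → x ≠ y → x ≠ z → y ≠ z →
      IsLeaf G x ∨ IsLeaf G y ∨ IsLeaf G z) : IsCaterpillar G := by
  refine ⟨⟨hG, hacyc⟩, ?_⟩
  set H := G.induce {v : V | ¬ IsLeaf G v} with hH
  have hHacyc : H.IsAcyclic := hacyc.induce _
  by_cases hne : IsEmpty {v : V | ¬ IsLeaf G v}
  · exact ⟨0, ⟨{ toEquiv := Equiv.equivOfIsEmpty _ _, map_rel_iff' := fun {x} => hne.elim x }⟩⟩
  rw [not_isEmpty_iff] at hne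
  obtain ⟨u, v, p, hp, hmax⟩ :=
    SimpleGraph.Walk.exists_isPath_forall_isPath_length_le_length H
  have hclosed : ∀ x ∈ p.support, ∀ y, H.Adj x y → y ∈ p.support := by
    intro x hx y hxy
    by_contra hy
    obtain ⟨i, rfl, hi⟩ := SimpleGraph.Walk.mem_support_iff_exists_getVert.1 hx
    by_cases hi0 : i = 0
    · subst hi0
      rw [SimpleGraph.Walk.getVert_zero] at hxy
      have := hmax _ _ (.cons hxy.symm p) (hp.cons hy)
      simp at this
    by_cases hil : i = p.length
    · subst hil
      rw [SimpleGraph.Walk.getVert_length] at hxy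
      have := hmax _ _ (p.concat hxy) (hp.concat hy hxy)
      simp at this
    have hpred := p.adj_getVert_succ (i := i - 1) (by omega)
    rw [Nat.sub_add_cancel (by omega)] at hpred
    have hsucc := p.adj_getVert_succ (i := i) (by omega)
    rcases hspider _ _ _ _ hpred.symm hsucc hxy
      (fun h => by
        have := hp.getVert_injOn (by simp; omega) (by simp; omega) (Subtype.ext h)
        omega)
      (fun h => hy (Subtype.ext h ▸ p.getVert_mem_support _))
      (fun h => hy (Subtype.ext h ▸ p.getVert_mem_support _)) with h | h | h
    exacts [(p.getVert _).2 h, (p.getVert _).2 h, y.2 h]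
  have hall : ∀ x, x ∈ p.support := by
    rintro ⟨x, hx⟩
    rcases forall_mem_of_adj_closed hG
        (s := {x | (∃ y ∈ p.support, y.1 = x) ∨ IsLeaf G x ∧ ∃ y ∈ p.support, G.Adj x y.1})
        (v := u.1) (Or.inl ⟨u, p.start_mem_support, rfl⟩) (by
          rintro x (⟨z, hz, rfl⟩ | ⟨hx, z, hz, hxz⟩) y hxy
          · by_cases hy : IsLeaf G y
            · exact Or.inr ⟨hy, z, hz, hxy.symm⟩
            · exact Or.inl ⟨⟨y, hy⟩, hclosed z hz ⟨y, hy⟩ hxy, rfl⟩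
          · exact Or.inl ⟨z, hz, hx.unique hxz hxy⟩) x with ⟨y, hy, rfl⟩ | ⟨h, -⟩
    · exact hy
    · exact absurd h hx
  have hchord : ∀ i j, i < j → j ≤ p.length → H.Adj (p.getVert i) (p.getVert j) →
      i + 1 = j := by
    intro i j hij hj hadj
    have h := hHacyc.eq_snd_of_adj_start (hp.drop i) hadj
      (SimpleGraph.Walk.mem_support_iff_exists_getVert.2
        ⟨j - i, by rw [SimpleGraph.Walk.drop_getVert]; congr 1; omega, by simp; omega⟩)
    rw [SimpleGraph.Walk.snd, SimpleGraph.Walk.drop_getVert] at h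
    exact (hp.getVert_injOn (by simpa using hj) (by simp; omega) h).symm
  let f : Fin (p.length + 1) → {v : V | ¬ IsLeaf G v} := fun i => p.getVert i
  have hf : Function.Bijective f := by
    constructor
    · intro i j hij
      exact Fin.ext (hp.getVert_injOn (by simp; omega) (by simp; omega) hij)
    · intro x
      obtain ⟨i, hi, hil⟩ := SimpleGraph.Walk.mem_support_iff_exists_getVert.1 (hall x)
      exact ⟨⟨i, by omega⟩, hi⟩
  refine ⟨p.length + 1, ⟨SimpleGraph.Iso.symm
    { toEquiv := Equiv.ofBijective f hf, map_rel_iff' := ?_ }⟩⟩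
  intro i j
  rw [SimpleGraph.pathGraph_adj]
  constructor
  · intro h
    change H.Adj (p.getVert i) (p.getVert j) at h
    rcases lt_trichotomy i.1 j.1 with hij | hij | hij
    · exact Or.inl (hchord _ _ hij (by omega) h)
    · rw [hij] at h
      exact absurd h (H.irrefl)
    · exact Or.inr (hchord _ _ hij (by omega) h.symm)
  · rintro (h | h)
    · change H.Adj (p.getVert i) (p.getVert j)
      rw [← h]
      exact p.adj_getVert_succ (by omega)
    · change H.Adj (p.getVert i) (p.getVert j)
      rw [← h]
      exact (p.adj_getVert_succ (by omega)).symm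

end Spine

section Cop

/-- One cop can reach `v` by a lazy walk of `T` steps such that the robber, if not yet caught,
is then outside `C`. -/
def Clears (G : SimpleGraph V) (v : V) (C : Set V) : Prop :=
  ∃ (T : ℕ) (w : ℕ → V), LazyWalk G w ∧ w T = v ∧ ∀ f : ℕ → V, LazyWalk G f →
    f T ∈ C → ∃ t ≤ T, f t = w t ∨ t < T ∧ f t = w (t + 1)

theorem clears_singleton (v : V) : Clears G v {v} :=
  ⟨0, fun _ => v, fun _ => Or.inl rfl, rfl, fun _ _ h => ⟨0, le_rfl, Or.inl h⟩⟩

theorem Clears.step {u v : V} {C C' : Set V} (h : Clears G v C) (hvu : G.Adj v u)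
    (hC : ∀ x ∈ C', x ≠ u → ∀ y, y = x ∨ G.Adj x y → y ≠ u → y ∈ C) : Clears G u C' := by
  obtain ⟨T, w, hw, rfl, hcatch⟩ := h
  refine ⟨T + 1, fun t => if t ≤ T then w t else u, fun t => ?_, by simp, fun f hf hfC => ?_⟩
  · rcases lt_trichotomy t T with ht | rfl | ht
    · simpa [ht.le, Nat.succ_le_of_lt ht] using hw t
    · simpa using Or.inr hvu
    · simp [ht.not_ge, (ht.trans (Nat.lt_succ_self t)).not_ge]
  by_cases hu : f (T + 1) = u
  · exact ⟨T + 1, le_rfl, Or.inl (by simpa using hu)⟩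
  by_cases hu' : f T = u
  · exact ⟨T, by omega, Or.inr ⟨by omega, by simpa using hu'⟩⟩
  obtain ⟨t, ht, h⟩ := hcatch f hf
    (hC _ hfC hu (f T) ((hf T).imp Eq.symm SimpleGraph.Adj.symm) hu')
  refine ⟨t, by omega, ?_⟩
  rcases h with h | ⟨h, h'⟩
  · exact Or.inl (by simpa [ht] using h)
  · exact Or.inr ⟨by omega, by simpa [Nat.succ_le_of_lt h] using h'⟩

theorem Clears.exists_winning {v : V} (h : Clears G v Set.univ)
    (vis : (Fin 1 → V) → V → Prop) : ∃ S : CopStrategy V 1, WinningCopStrategy G vis S := by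
  obtain ⟨T, w, hw, -, hcatch⟩ := h
  refine exists_winning_of_lazyWalk vis hw T fun f hf => ?_
  obtain ⟨t, ht, h⟩ := hcatch f hf trivial
  exact ⟨t, ht, h.imp_right And.right⟩

/-- A spine `p 0, …, p n` such that each vertex `x` is `p (pos x)` or pendant at `p (pos x)`. -/
structure IsSpine (G : SimpleGraph V) (n : ℕ) (p : ℕ → V) (pos : V → ℕ) : Prop where
  pos_le : ∀ x, pos x ≤ n
  pos_apply : ∀ i ≤ n, pos (p i) = i
  adj_succ : ∀ i < n, G.Adj (p i) (p (i + 1))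
  adj_of_ne : ∀ x, x ≠ p (pos x) → G.Adj (p (pos x)) x
  pendant : ∀ x y, G.Adj x y → x ≠ p (pos x) → y = p (pos x)
  pos_le_succ : ∀ x y, G.Adj x y → pos y ≤ pos x + 1

theorem IsSpine.clears_univ [Finite V] {n : ℕ} {p : ℕ → V} {pos : V → ℕ}
    (h : IsSpine G n p pos) : Clears G (p n) Set.univ := by
  classical
  have := Fintype.ofFinite V
  have hpos : ∀ x y, G.Adj x y → pos x < pos y → y = p (pos y) := by
    intro x y hxy hlt
    by_contra hy
    have := h.pendant y x hxy.symm hy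
    have := h.pos_apply (pos y) (h.pos_le y)
    grind
  have hlegs : ∀ i ≤ n, Clears G (p i) {x | pos x < i ∨ x = p i} → ∀ L : Finset V,
      Clears G (p i) {x | pos x < i ∨ pos x = i ∧ (x = p i ∨ x ∈ L)} := by
    intro i hi h0 L
    induction L using Finset.induction with
    | empty =>
      convert h0 using 3 with x
      have := h.pos_apply i hi
      grind
    | insert l L _ ih =>
      by_cases hl : pos l = i ∧ l ≠ p i
      · obtain ⟨hl, hlp⟩ := hl
        have hadj : G.Adj (p i) l := hl ▸ h.adj_of_ne l (hl ▸ hlp)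
        refine (ih.step (u := l)
          (C' := {x | pos x < i ∨ pos x = i ∧ x ≠ p i ∧ (x = l ∨ x ∈ L)}) hadj ?_).step
          hadj.symm ?_
        · intro x hx hxl y hxy hyl
          have h1 := h.pos_le_succ x y
          have h2 := hpos x y
          have h3 := h.pendant x y
          have h4 := h.pos_apply i hi
          simp only [Set.mem_ofPred_eq] at hx ⊢
          grind
        · intro x hx hxl y hxy hyl
          have h1 := h.pos_le_succ x y
          have h2 := hpos x y
          have h3 := h.pendant x y
          have h4 := h.pos_apply i hi
          simp only [Set.mem_ofPred_eq, Finset.mem_insert] at hx ⊢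
          grind
      · convert ih using 3 with x
        grind
  have hspine : ∀ i ≤ n, Clears G (p i) {x | pos x < i ∨ x = p i} := by
    intro i
    induction i with
    | zero =>
      intro _
      convert clears_singleton (p 0) using 1
      ext x
      simp
    | succ i ih =>
      intro hi
      refine (hlegs i (by omega) (ih (by omega)) Finset.univ).step (h.adj_succ i hi) ?_
      intro x hx hxp y hxy hyp
      have h1 := h.pos_le_succ x y
      have h2 := hpos x y
      simp only [Set.mem_ofPred_eq, Finset.mem_univ] at hx ⊢
      grind
  convert hlegs n le_rfl (hspine n le_rfl) Finset.univ using 1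
  ext x
  have := h.pos_le x
  simp
  omega

theorem IsCaterpillar.exists_isSpine (h : IsCaterpillar G) :
    ∃ n p pos, IsSpine G n p pos := by
  classical
  obtain ⟨⟨hG, -⟩, n, ⟨e⟩⟩ := h
  have hpair : ∀ x y, IsLeaf G x → IsLeaf G y → G.Adj x y → ∀ z, z = x ∨ z = y := by
    intro x y hx hy hxy
    refine forall_mem_of_adj_closed hG (s := {z | z = x ∨ z = y}) (v := x) (Or.inl rfl) ?_
    rintro z (rfl | rfl) t ht
    · exact Or.inr (hx.unique ht hxy)
    · exact Or.inl (hy.unique ht hxy.symm)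
  rcases n with _ | n
  · have hleaf : ∀ x, IsLeaf G x := fun x => by
      by_contra hx
      exact (e ⟨x, hx⟩).elim0
    obtain ⟨x⟩ := hG.nonempty
    obtain ⟨y, hxy, -⟩ := hleaf x
    have hz := hpair x y (hleaf x) (hleaf y) hxy
    refine ⟨0, fun _ => x, fun _ => 0, by simp, by simp, by simp, ?_, ?_, by simp⟩
    · intro z hzx
      rwa [(hz z).resolve_left hzx]
    · intro z t hzt hzx
      have hzy := (hz z).resolve_left hzx
      subst hzy
      exact (hz t).resolve_right hzt.ne'
  have hnl : ∀ x, IsLeaf G x → ∀ y, G.Adj x y → ¬ IsLeaf G y := by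
    intro x hx y hxy hy
    have hq := (e.symm 0).2
    rcases hpair x y hx hy hxy (e.symm 0).1 with h | h
    · exact hq (h ▸ hx)
    · exact hq (h ▸ hy)
  let base : V → {v : V | ¬ IsLeaf G v} := fun x =>
    if hx : IsLeaf G x then ⟨hx.choose, hnl x hx _ hx.choose_spec.1⟩ else ⟨x, hx⟩
  have hbase : ∀ x (hx : ¬ IsLeaf G x), base x = ⟨x, hx⟩ := fun x hx => dif_neg hx
  have hleaf : ∀ x y, IsLeaf G x → (G.Adj x y ↔ y = base x) := by
    intro x y hx
    have : (base x).1 = hx.choose := by simp only [base, dif_pos hx]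
    rw [this]
    exact ⟨fun h => hx.choose_spec.2 y h, fun h => h ▸ hx.choose_spec.1⟩
  let p : ℕ → V := fun i => e.symm (Fin.ofNat (n + 1) i)
  let pos : V → ℕ := fun x => e (base x)
  have hp : ∀ x, p (pos x) = base x := by
    intro x
    simp [p, pos]
  have hpi : ∀ i ≤ n, pos (p i) = i := by
    intro i hi
    simp only [p, pos]
    rw [hbase _ (e.symm _).2]
    simp
    omega
  have hspine : ∀ x, ¬ IsLeaf G x ↔ x = p (pos x) := by
    intro x
    rw [hp]
    refine ⟨fun hx => by rw [hbase x hx], fun hx => hx ▸ (base x).2⟩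
  have hadj : ∀ x y, ¬ IsLeaf G x → ¬ IsLeaf G y → G.Adj x y →
      pos x + 1 = pos y ∨ pos y + 1 = pos x := by
    intro x y hx hy hxy
    have : (pathGraph (n + 1)).Adj (e ⟨x, hx⟩) (e ⟨y, hy⟩) := e.map_adj_iff.2 hxy
    rw [pathGraph_adj] at this
    simpa only [pos, hbase x hx, hbase y hy] using this
  refine ⟨n, p, pos, fun x => Nat.le_of_lt_succ (e (base x)).2, hpi, ?_, ?_, ?_, ?_⟩
  · intro i hi
    have : (pathGraph (n + 1)).Adj (Fin.ofNat (n + 1) i) (Fin.ofNat (n + 1) (i + 1)) := by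
      rw [pathGraph_adj]
      left
      simp [Fin.ofNat, Nat.mod_eq_of_lt (show i < n + 1 by omega),
        Nat.mod_eq_of_lt (show i + 1 < n + 1 by omega)]
    exact e.symm.map_adj_iff.2 this
  · intro x hx
    rw [Ne, ← hspine, not_not] at hx
    rw [hp]
    exact ((hleaf x _ hx).2 rfl).symm
  · intro x y hxy hx
    rw [Ne, ← hspine, not_not] at hx
    rw [hp]
    exact (hleaf x y hx).1 hxy
  · have hpend : ∀ x y, G.Adj x y → IsLeaf G x → pos x = pos y := by
      intro x y hxy hx
      have hy : y = base x := (hleaf x y hx).1 hxy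
      simp only [pos]
      rw [hbase y (hnl x hx y hxy)]
      congr 2
      exact Subtype.ext hy.symm
    intro x y hxy
    by_cases hx : IsLeaf G x
    · have := hpend x y hxy hx
      omega
    by_cases hy : IsLeaf G y
    · have := hpend y x hxy.symm hy
      omega
    · have := hadj x y hx hy hxy
      omega

end Cop

end SingleCopGame

/-- For `k ≥ 2` and a finite connected simple graph `G`, `c_{H,k}(G) = 1` iff `G` is a
caterpillar. -/
theorem stmt8 {V : Type} [Fintype V] (G : SimpleGraph V) (hG : G.Connected)
    (k : ℕ) (hk : 2 ≤ k) :
    hyperopicCopNumber G k = 1 ↔ IsCaterpillar G := by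
  have := hG.nonempty
  rw [hyperopicCopNumber_eq_one_iff]
  constructor
  · rintro ⟨S, hS⟩
    refine isCaterpillar_of_forall_not_spider hG (isAcyclic_of_winning hG hk hS) ?_
    intro a x y z hx hy hz hxy hxz hyz
    by_contra! hl
    obtain ⟨c, hc, hca⟩ := exists_adj_ne_of_not_isLeaf hl.1 hx.symm
    obtain ⟨d, hd, hda⟩ := exists_adj_ne_of_not_isLeaf hl.2.1 hy.symm
    obtain ⟨e, he, hea⟩ := exists_adj_ne_of_not_isLeaf hl.2.2 hz.symm
    refine (isEvasion_spider (a := a) (b := ![x, y, z]) (c := ![c, d, e]) ?_ ?_ ?_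
      ?_).not_winning hG hk S hS
    · intro i j hij
      fin_cases i <;> fin_cases j <;> simp_all
    all_goals
      intro i
      fin_cases i <;> simpa
  · intro h
    obtain ⟨n, p, pos, hs⟩ := h.exists_isSpine
    exact hs.clears_univ.exists_winning _

end CopsRobber
end

section
/- Let T be a finite tree that is not a caterpillar. Then T contains a subgraph isomorphic to T̂, the tree on 7 vertices obtained from the star K_{1,3} by subdividing each of its three edges exactly once. -/
namespace CopsRobber

open SimpleGraph

/-- The tree `T̂` on 7 vertices obtained from the star `K_{1,3}` by subdividing each edge
once: vertex `0` is the centre, `1, 2, 3` are its neighbours, and `4, 5, 6` are the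
corresponding further leaves. -/
def hatT : SimpleGraph (Fin 7) :=
  SimpleGraph.fromRel fun u v =>
    (u = 0 ∧ v = 1) ∨ (u = 0 ∧ v = 2) ∨ (u = 0 ∧ v = 3) ∨
      (u = 1 ∧ v = 4) ∨ (u = 2 ∧ v = 5) ∨ (u = 3 ∧ v = 6)

/-- In an acyclic graph two distinct vertices have at most one common neighbour. -/
theorem eq_of_common_neighbors {V : Type*} {G : SimpleGraph V} (hG : G.IsAcyclic)
    {x a b w : V} (hxa : G.Adj x a) (hxb : G.Adj x b) (haw : G.Adj a w) (hbw : G.Adj b w)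
    (hab : a ≠ b) : w = x := by
  by_contra hwx
  have hp : (Walk.cons hxa (.cons haw .nil)).IsPath := by
    simp [hxa.ne, haw.ne, Ne.symm hwx]
  have hq : (Walk.cons hxb (.cons hbw .nil)).IsPath := by
    simp [hxb.ne, hbw.ne, Ne.symm hwx]
  have h := congrArg (fun p : G.Path x w => p.1.snd)
    ((hG.subsingleton_path _ _).elim ⟨_, hp⟩ ⟨_, hq⟩)
  exact hab (by simpa using h)

/-- An acyclic graph contains no triangle. -/
theorem not_adj_of_common_neighbor {V : Type*} {G : SimpleGraph V} (hG : G.IsAcyclic)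
    {x a b : V} (hxa : G.Adj x a) (hxb : G.Adj x b) : ¬ G.Adj a b := by
  intro hab
  have hp : (Walk.cons hxa (.cons hab .nil)).IsPath := by
    simp [hxa.ne, hab.ne, hxb.ne]
  have hq : (Walk.cons hxb .nil).IsPath := by simp [hxb.ne]
  have h := congrArg (fun p : G.Path x b => p.1.length)
    ((hG.subsingleton_path _ _).elim ⟨_, hp⟩ ⟨_, hq⟩)
  simp at h

/-- The vertices of a path in an acyclic graph are adjacent only if they are consecutive. -/
theorem getVert_adj_getVert_iff {V : Type*} {G : SimpleGraph V} (hG : G.IsAcyclic) {u v : V}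
    {p : G.Walk u v} (hp : p.IsPath) {i j : ℕ} (hi : i ≤ p.length) (hj : j ≤ p.length) :
    G.Adj (p.getVert i) (p.getVert j) ↔ i + 1 = j ∨ j + 1 = i := by
  have key : ∀ {i j : ℕ}, i ≤ j → j ≤ p.length → G.Adj (p.getVert i) (p.getVert j) →
      i + 1 = j := by
    intro i j hij hj hadj
    have hne : i ≠ j := by
      rintro rfl
      exact hadj.ne rfl
    have hmem : p.getVert j ∈ (p.drop i).support :=
      Walk.mem_support_iff_exists_getVert.mpr
        ⟨j - i, by rw [Walk.drop_getVert]; congr 1; omega, by rw [Walk.drop_length]; omega⟩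
    have h := hG.eq_snd_of_adj_start (hp.drop i) hadj hmem
    rw [Walk.snd, Walk.drop_getVert] at h
    exact (hp.getVert_injOn (by simpa using hj) (by simp; omega) h).symm
  constructor
  · intro h
    rcases le_total i j with hij | hij
    · exact .inl (key hij hj h)
    · exact .inr (key hij hi h.symm)
  · rintro (rfl | rfl)
    · exact p.adj_getVert_succ (by omega)
    · exact (p.adj_getVert_succ (by omega)).symm

/-- In a connected graph in which no vertex has three distinct neighbours, a path of maximal
length visits every vertex. -/
theorem mem_support_of_isPath_of_maximal {V : Type*} {G : SimpleGraph V} (hG : G.Preconnected)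
    (hdeg : ∀ x a b c, G.Adj x a → G.Adj x b → G.Adj x c → a ≠ b → a ≠ c → b ≠ c → False)
    {u v : V} {p : G.Walk u v} (hp : p.IsPath)
    (hmax : ∀ (u' v' : V) (p' : G.Walk u' v'), p'.IsPath → p'.length ≤ p.length) (w : V) :
    w ∈ p.support := by
  by_contra hw
  obtain ⟨q⟩ := hG u w
  obtain ⟨d, -, hd₁, hd₂⟩ := q.exists_boundary_dart {x | x ∈ p.support} p.start_mem_support hw
  obtain ⟨i, hi, hip⟩ := Walk.mem_support_iff_exists_getVert.mp hd₁
  have hd₂ : d.snd ∉ p.support := hd₂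
  have hadj : G.Adj (p.getVert i) d.snd := hi ▸ d.adj
  rcases Nat.eq_zero_or_pos i with rfl | hi₀
  · rw [Walk.getVert_zero] at hadj
    have := hmax _ _ (.cons hadj.symm p) (hp.cons hd₂)
    simp at this
  rcases hip.eq_or_lt with rfl | hil
  · rw [Walk.getVert_length] at hadj
    have := hmax _ _ (p.concat hadj) (hp.concat hd₂ hadj)
    simp at this
  · have hprev : G.Adj (p.getVert i) (p.getVert (i - 1)) := by
      have := p.adj_getVert_succ (i := i - 1) (by omega)
      rw [Nat.sub_add_cancel hi₀] at this
      exact this.symm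
    refine hdeg _ _ _ _ hprev (p.adj_getVert_succ hil) hadj (fun h => ?_) ?_ ?_
    · have := hp.getVert_injOn (by simp; omega) (by simp; omega) h
      omega
    · exact fun h => hd₂ (h ▸ p.getVert_mem_support _)
    · exact fun h => hd₂ (h ▸ p.getVert_mem_support _)

/-- A finite connected acyclic graph in which no vertex has three distinct neighbours is a
(possibly empty) path. -/
theorem exists_iso_pathGraph {V : Type*} [Finite V] {G : SimpleGraph V} (hc : G.Preconnected)
    (ha : G.IsAcyclic)
    (hdeg : ∀ x a b c, G.Adj x a → G.Adj x b → G.Adj x c → a ≠ b → a ≠ c → b ≠ c → False) :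
    ∃ n : ℕ, Nonempty (G ≃g pathGraph n) := by
  rcases isEmpty_or_nonempty V with hV | hV
  · exact ⟨0, ⟨⟨Equiv.equivOfIsEmpty _ _, fun {a} => (hV.false a).elim⟩⟩⟩
  obtain ⟨u, v, p, hp, hmax⟩ := Walk.exists_isPath_forall_isPath_length_le_length G
  let f : Fin (p.length + 1) → V := fun i => p.getVert i
  have hf : Function.Bijective f := by
    constructor
    · intro i j hij
      exact Fin.ext (hp.getVert_injOn (Nat.lt_succ_iff.mp i.2) (Nat.lt_succ_iff.mp j.2) hij)
    · intro w
      obtain ⟨i, hi, hip⟩ := Walk.mem_support_iff_exists_getVert.mp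
        (mem_support_of_isPath_of_maximal hc hdeg hp hmax w)
      exact ⟨⟨i, Nat.lt_succ_iff.mpr hip⟩, hi⟩
  let e : pathGraph (p.length + 1) ≃g G :=
    ⟨Equiv.ofBijective f hf, fun {i j} => by
      rw [pathGraph_adj]
      exact getVert_adj_getVert_iff ha hp (Nat.lt_succ_iff.mp i.2) (Nat.lt_succ_iff.mp j.2)⟩
  exact ⟨_, ⟨e.symm⟩⟩

/-- A vertex with a neighbour `x` that is not a leaf has a neighbour other than `x`. -/
theorem exists_adj_ne_of_not_isLeaf_s9 {V : Type} {G : SimpleGraph V} {x a : V} (hxa : G.Adj x a)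
    (ha : ¬ IsLeaf G a) : ∃ w, G.Adj a w ∧ w ≠ x := by
  by_contra! h
  exact ha ⟨x, hxa.symm, h⟩

/-- An acyclic graph with a vertex having three distinct non-leaf neighbours contains `T̂`. -/
theorem exists_hatT_embedding {V : Type} {G : SimpleGraph V} (hG : G.IsAcyclic) {x a b c : V}
    (hxa : G.Adj x a) (hxb : G.Adj x b) (hxc : G.Adj x c) (hab : a ≠ b) (hac : a ≠ c)
    (hbc : b ≠ c) (ha : ¬ IsLeaf G a) (hb : ¬ IsLeaf G b) (hc : ¬ IsLeaf G c) :
    ∃ g : Fin 7 ↪ V, ∀ u v : Fin 7, hatT.Adj u v → G.Adj (g u) (g v) := by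
  obtain ⟨a', haa, hax⟩ := exists_adj_ne_of_not_isLeaf_s9 hxa ha
  obtain ⟨b', hbb, hbx⟩ := exists_adj_ne_of_not_isLeaf_s9 hxb hb
  obtain ⟨c', hcc, hcx⟩ := exists_adj_ne_of_not_isLeaf_s9 hxc hc
  have far : ∀ {y z y' : V}, G.Adj x y → G.Adj x z → G.Adj y y' → y' ≠ z := by
    rintro y z _ hy hz hyy rfl
    exact not_adj_of_common_neighbor hG hy hz hyy
  have apart : ∀ {y z y' z' : V}, G.Adj x y → G.Adj x z → y ≠ z → G.Adj y y' → G.Adj z z' →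
      y' ≠ x → y' ≠ z' := by
    rintro y z y' _ hy hz hyz hyy hzz hne rfl
    exact hne (eq_of_common_neighbors hG hy hz hyy hzz hyz)
  have h₁ := far hxa hxb haa
  have h₂ := far hxa hxc haa
  have h₃ := far hxb hxa hbb
  have h₄ := far hxb hxc hbb
  have h₅ := far hxc hxa hcc
  have h₆ := far hxc hxb hcc
  have h₇ := apart hxa hxb hab haa hbb hax
  have h₈ := apart hxa hxc hac haa hcc hax
  have h₉ := apart hxb hxc hbc hbb hcc hbx
  refine ⟨⟨![x, a, b, c, a', b', c'], ?_⟩, ?_⟩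
  · rw [← List.nodup_ofFn]
    simp [hxa.ne, hxb.ne, hxc.ne, haa.ne, hbb.ne, hcc.ne, hax.symm, hbx.symm, hcx.symm, hab, hac,
      hbc, h₁.symm, h₂.symm, h₃.symm, h₄.symm, h₅.symm, h₆.symm, h₇, h₈, h₉]
  · intro u v huv
    have key : ∀ u v : Fin 7, ((u = 0 ∧ v = 1) ∨ (u = 0 ∧ v = 2) ∨ (u = 0 ∧ v = 3) ∨
        (u = 1 ∧ v = 4) ∨ (u = 2 ∧ v = 5) ∨ (u = 3 ∧ v = 6)) →
        G.Adj (![x, a, b, c, a', b', c'] u) (![x, a, b, c, a', b', c'] v) := by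
      rintro u v (⟨rfl, rfl⟩ | ⟨rfl, rfl⟩ | ⟨rfl, rfl⟩ | ⟨rfl, rfl⟩ | ⟨rfl, rfl⟩ | ⟨rfl, rfl⟩)
      exacts [hxa, hxb, hxc, haa, hbb, hcc]
    rcases huv.2 with h | h
    · exact key u v h
    · exact (key v u h).symm

/-- Every finite tree that is not a caterpillar contains a subgraph isomorphic to `T̂`, the
tree obtained from `K_{1,3}` by subdividing each edge once. -/
theorem stmt9 {V : Type} [Fintype V] (T : SimpleGraph V) (hT : T.IsTree)
    (hcat : ¬ IsCaterpillar T) :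
    ∃ g : Fin 7 ↪ V, ∀ u v : Fin 7, hatT.Adj u v → T.Adj (g u) (g v) := by
  by_contra hcon
  refine hcat ⟨hT, exists_iso_pathGraph ?_ (hT.isAcyclic.induce _) ?_⟩
  · refine hT.connected.preconnected.induce_of_degree_eq_one fun v hv => ?_
    obtain ⟨w, -, hw⟩ : IsLeaf T v := by simpa using hv
    exact fun y hy z hz => (hw y hy).trans (hw z hz).symm
  · intro x a b c hxa hxb hxc hab hac hbc
    exact hcon (exists_hatT_embedding hT.isAcyclic hxa hxb hxc
      (Subtype.coe_injective.ne hab) (Subtype.coe_injective.ne hac)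
      (Subtype.coe_injective.ne hbc) a.2 b.2 c.2)

end CopsRobber
end

section
/- Let G be a finite connected simple graph on n vertices. If G has a perfect matching, then c_0(G) ≤ α'(G); otherwise c_0(G) ≤ α'(G) + 1. Moreover, in both cases c_0(G) ≤ ⌈n/2⌉. -/
namespace CopsRobber

open SimpleGraph

/-- The matching number `α'(G)`: the maximum number of edges in a matching of `G`. -/
noncomputable def matchingNumber {V : Type} (G : SimpleGraph V) : ℕ :=
  sSup {n | ∃ M : G.Subgraph, M.IsMatching ∧ M.edgeSet.ncard = n}

open Classical in
/-- The cop strategy that follows a fixed schedule `pos`, using only the number of rounds played;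
a cop that is not on schedule stays put. -/
noncomputable def scheduleStrategy {V : Type} {d : ℕ} (pos : ℕ → Fin d → V) : CopStrategy V d where
  init := pos 0
  move h p i := if p i = pos (h.length - 1) i then pos h.length i else p i

theorem play_observations_length {V : Type} {d : ℕ} (vis : (Fin d → V) → V → Prop)
    (S : CopStrategy V d) (R : RobberStrategy V d) (n : ℕ) :
    (play vis S R n).2.1.length = n := by
  induction n with
  | zero => rfl
  | succ n ih => simp [play, ih]

theorem copPos_scheduleStrategy {V : Type} {d : ℕ} (vis : (Fin d → V) → V → Prop)
    (pos : ℕ → Fin d → V) (R : RobberStrategy V d) (n : ℕ) :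
    copPos vis (scheduleStrategy pos) R n = pos n := by
  induction n with
  | zero => rfl
  | succ n ih =>
    unfold copPos at ih
    funext i
    simp [copPos, play, scheduleStrategy, play_observations_length] at ih ⊢
    simp [ih]

theorem scheduleStrategy_legal {V : Type} {G : SimpleGraph V} {d : ℕ} {pos : ℕ → Fin d → V}
    (hpos : ∀ n i, pos (n + 1) i = pos n i ∨ G.Adj (pos n i) (pos (n + 1) i)) :
    (scheduleStrategy pos).Legal G := by
  intro h p i
  simp only [scheduleStrategy]
  split_ifs with hp
  · rcases h with _ | ⟨o, h⟩
    · exact .inl hp.symm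
    · simpa [hp] using hpos h.length i
  · exact .inl rfl

theorem robPos_succ_s10 {V : Type} {G : SimpleGraph V} {d : ℕ} (vis : (Fin d → V) → V → Prop)
    (S : CopStrategy V d) {R : RobberStrategy V d} (hR : R.Legal G) (n : ℕ) :
    robPos vis S R (n + 1) = robPos vis S R n ∨
      G.Adj (robPos vis S R n) (robPos vis S R (n + 1)) :=
  hR _ _ _

/-- A schedule of legal cop moves that meets every legal robber trajectory bounds the
0-visibility cop number by the number of cops. -/
theorem zeroVisCopNumber_le_of_schedule {V ι : Type} [Fintype ι] {G : SimpleGraph V}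
    (pos : ℕ → ι → V)
    (hpos : ∀ n i, pos (n + 1) i = pos n i ∨ G.Adj (pos n i) (pos (n + 1) i))
    (hcatch : ∀ r : ℕ → V, (∀ n, r (n + 1) = r n ∨ G.Adj (r n) (r (n + 1))) →
      ∃ n i, pos n i = r n ∨ pos (n + 1) i = r n) :
    zeroVisCopNumber G ≤ Fintype.card ι := by
  let e := Fintype.equivFin ι
  refine Nat.sInf_le ⟨scheduleStrategy fun n i ↦ pos n (e.symm i),
    scheduleStrategy_legal fun n i ↦ hpos n _, fun R hR ↦ ?_⟩
  obtain ⟨n, i, h⟩ := hcatch _ (robPos_succ_s10 _ _ hR)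
  refine ⟨n, e i, ?_⟩
  simpa only [copPos_scheduleStrategy, Equiv.symm_apply_apply] using h

/-- A finite connected graph has a walk through all vertices. -/
theorem exists_walk_forall_mem_support {V : Type} [Fintype V] {G : SimpleGraph V}
    (hG : G.Connected) : ∃ (u v : V) (w : G.Walk u v), ∀ x, x ∈ w.support := by
  classical
  obtain ⟨u⟩ := hG.nonempty
  suffices ∀ s : Finset V, ∃ (v : V) (w : G.Walk u v), ∀ x ∈ s, x ∈ w.support by
    obtain ⟨v, w, hw⟩ := this Finset.univ
    exact ⟨u, v, w, fun x ↦ hw x (Finset.mem_univ x)⟩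
  intro s
  induction s using Finset.induction_on with
  | empty => exact ⟨u, .nil, by simp⟩
  | insert a s _ ih =>
    obtain ⟨v, w, hw⟩ := ih
    obtain ⟨w'⟩ := hG.preconnected v a
    refine ⟨a, w.append w', fun x hx ↦ ?_⟩
    rw [Walk.mem_support_append_iff]
    rcases Finset.mem_insert.1 hx with rfl | hx
    · exact .inr w'.end_mem_support
    · exact .inl (hw x hx)

/-- The two ends of an edge of the subgraph `M`, indexed by `Bool`. -/
noncomputable def edgeEnd {V : Type} {G : SimpleGraph V} {M : G.Subgraph} (e : M.edgeSet)
    (b : Bool) : V :=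
  bif b then (Quot.out e.1).1 else (Quot.out e.1).2

theorem mk_edgeEnd {V : Type} {G : SimpleGraph V} {M : G.Subgraph} (e : M.edgeSet) (b : Bool) :
    s(edgeEnd e b, edgeEnd e (!b)) = e.1 := by
  have h : s((Quot.out e.1).1, (Quot.out e.1).2) = e.1 := Quot.out_eq e.1
  cases b
  · rw [Sym2.eq_swap]; exact h
  · exact h

theorem adj_edgeEnd {V : Type} {G : SimpleGraph V} {M : G.Subgraph} (e : M.edgeSet) (b : Bool) :
    M.Adj (edgeEnd e b) (edgeEnd e (!b)) := by
  rw [← Subgraph.mem_edgeSet, mk_edgeEnd]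
  exact e.2

theorem exists_edgeEnd_eq {V : Type} {G : SimpleGraph V} {M : G.Subgraph} (hM : M.IsMatching)
    {v : V} (hv : v ∈ M.verts) : ∃ (e : M.edgeSet) (b : Bool), edgeEnd e b = v := by
  obtain ⟨w, hw, -⟩ := hM hv
  let e : M.edgeSet := ⟨s(v, w), hw⟩
  have h : s(edgeEnd e true, edgeEnd e false) = s(v, w) := mk_edgeEnd e true
  rcases Sym2.eq_iff.1 h with h | h
  · exact ⟨e, true, h.1⟩
  · exact ⟨e, false, h.2⟩

theorem edgeEnd_injective {V : Type} {G : SimpleGraph V} {M : G.Subgraph} (hM : M.IsMatching) :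
    Function.Injective fun p : M.edgeSet × Bool ↦ edgeEnd p.1 p.2 := by
  rintro ⟨e, b⟩ ⟨e', b'⟩ h
  dsimp only at h
  have h₁ := adj_edgeEnd e b
  have h₂ := adj_edgeEnd e' b'
  rw [← h] at h₂
  have hne : edgeEnd e (!b) = edgeEnd e' (!b') := hM.eq_of_adj_left h₁ h₂
  have hee : e = e' := Subtype.ext (by rw [← mk_edgeEnd e b, ← mk_edgeEnd e' b', h, hne])
  subst hee
  cases b <;> cases b' <;> first | rfl | exact absurd h h₁.ne

theorem two_mul_ncard_edgeSet_le {V : Type} [Fintype V] {G : SimpleGraph V} {M : G.Subgraph}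
    (hM : M.IsMatching) : 2 * M.edgeSet.ncard ≤ Fintype.card V := by
  classical
  have := Nat.card_le_card_of_injective _ (edgeEnd_injective hM)
  rw [Nat.card_prod, Nat.card_coe_set_eq, Nat.card_eq_fintype_card (α := V)] at this
  simpa [mul_comm] using this

theorem IsMatching.isPerfectMatching_of_card {V : Type} [Fintype V] {G : SimpleGraph V}
    {M : G.Subgraph} (hM : M.IsMatching) (h : 2 * M.edgeSet.ncard = Fintype.card V) :
    M.IsPerfectMatching := by
  classical
  have hbij := (Fintype.bijective_iff_injective_and_card _).2 ⟨edgeEnd_injective hM, by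
    rw [← h, ← Nat.card_eq_fintype_card, Nat.card_prod, Nat.card_coe_set_eq]
    simp [mul_comm]⟩
  refine ⟨hM, fun v ↦ ?_⟩
  obtain ⟨⟨e, b⟩, rfl⟩ := hbij.2 v
  exact (adj_edgeEnd e b).fst_mem

theorem bddAbove_matching_sizes {V : Type} [Fintype V] (G : SimpleGraph V) :
    BddAbove {n | ∃ M : G.Subgraph, M.IsMatching ∧ M.edgeSet.ncard = n} := by
  refine ⟨Fintype.card V, ?_⟩
  rintro _ ⟨M, hM, rfl⟩
  have := two_mul_ncard_edgeSet_le hM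
  lia

theorem ncard_edgeSet_le_matchingNumber {V : Type} [Fintype V] {G : SimpleGraph V}
    {M : G.Subgraph} (hM : M.IsMatching) : M.edgeSet.ncard ≤ matchingNumber G :=
  le_csSup (bddAbove_matching_sizes G) ⟨M, hM, rfl⟩

theorem exists_ncard_edgeSet_eq_matchingNumber {V : Type} [Fintype V] (G : SimpleGraph V) :
    ∃ M : G.Subgraph, M.IsMatching ∧ M.edgeSet.ncard = matchingNumber G :=
  Nat.sSup_mem (s := {n | ∃ M : G.Subgraph, M.IsMatching ∧ M.edgeSet.ncard = n})
    ⟨_, ⊥, fun _ hv ↦ hv.elim, rfl⟩ (bddAbove_matching_sizes G)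

/-- The vertices missed by a maximum matching form an independent set. -/
theorem not_adj_of_notMem_verts {V : Type} [Fintype V] {G : SimpleGraph V} {M : G.Subgraph}
    (hM : M.IsMatching) (hmax : M.edgeSet.ncard = matchingNumber G) {u v : V}
    (hu : u ∉ M.verts) (hv : v ∉ M.verts) : ¬ G.Adj u v := by
  intro huv
  have hsup : (M ⊔ G.subgraphOfAdj huv).IsMatching := by
    refine hM.sup (Subgraph.IsMatching.subgraphOfAdj huv) ?_
    rw [hM.support_eq_verts, (Subgraph.IsMatching.subgraphOfAdj huv).support_eq_verts]
    simp [hu, hv]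
  have hle := ncard_edgeSet_le_matchingNumber hsup
  have hnot : s(u, v) ∉ M.edgeSet := fun h ↦ hu (M.edge_vert h)
  rw [Subgraph.edgeSet_sup, edgeSet_subgraphOfAdj, Set.union_singleton,
    Set.ncard_insert_of_notMem hnot (Set.toFinite _)] at hle
  lia

/-- The positions of cops that each patrol one edge of `M`, switching ends in every round. -/
noncomputable def patrol {V : Type} {G : SimpleGraph V} (M : G.Subgraph) (n : ℕ)
    (e : M.edgeSet) : V :=
  edgeEnd e n.bodd

theorem adj_patrol {V : Type} {G : SimpleGraph V} (M : G.Subgraph) (n : ℕ) (e : M.edgeSet) :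
    G.Adj (patrol M n e) (patrol M (n + 1) e) := by
  simpa [patrol] using (adj_edgeEnd e n.bodd).adj_sub

/-- Patrolling cops catch a robber on any matched vertex by their next move. -/
theorem exists_patrol_eq {V : Type} {G : SimpleGraph V} {M : G.Subgraph} (hM : M.IsMatching)
    (n : ℕ) {v : V} (hv : v ∈ M.verts) : ∃ e, patrol M n e = v ∨ patrol M (n + 1) e = v := by
  obtain ⟨e, b, rfl⟩ := exists_edgeEnd_eq hM hv
  refine ⟨e, ?_⟩
  simp only [patrol, Nat.bodd_succ]
  cases b <;> cases n.bodd <;> simp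

theorem zeroVisCopNumber_le_of_isPerfectMatching {V : Type} [Fintype V] {G : SimpleGraph V}
    {M : G.Subgraph} (hM : M.IsPerfectMatching) : zeroVisCopNumber G ≤ M.edgeSet.ncard := by
  classical
  have h := zeroVisCopNumber_le_of_schedule (patrol M) (fun n e ↦ .inr (adj_patrol M n e))
    fun r _ ↦ ⟨0, exists_patrol_eq hM.1 0 (hM.2 (r 0))⟩
  rwa [← Nat.card_eq_fintype_card, Nat.card_coe_set_eq] at h

theorem zeroVisCopNumber_le_matchingNumber_add_one {V : Type} [Fintype V] {G : SimpleGraph V}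
    (hG : G.Connected) : zeroVisCopNumber G ≤ matchingNumber G + 1 := by
  classical
  obtain ⟨M, hM, hmax⟩ := exists_ncard_edgeSet_eq_matchingNumber G
  obtain ⟨u, v, w, hw⟩ := exists_walk_forall_mem_support hG
  have h := zeroVisCopNumber_le_of_schedule (G := G)
    (fun n (o : Option M.edgeSet) ↦ o.elim (w.getVert n) (patrol M n)) ?_ ?_
  · rwa [Fintype.card_option, ← Nat.card_eq_fintype_card, Nat.card_coe_set_eq, hmax] at h
  · rintro n (_ | e)
    · rcases lt_or_ge n w.length with hn | hn
      · exact .inr (w.adj_getVert_succ hn)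
      · exact .inl (by simp [w.getVert_of_length_le hn, w.getVert_of_length_le (hn.trans n.le_succ)])
    · exact .inr (adj_patrol M n e)
  · intro r hr
    by_cases hin : ∃ n, r n ∈ M.verts
    · obtain ⟨n, hn⟩ := hin
      obtain ⟨e, he⟩ := exists_patrol_eq hM n hn
      exact ⟨n, some e, he⟩
    · push Not at hin
      have hconst : ∀ n, r n = r 0 := by
        intro n
        induction n with
        | zero => rfl
        | succ n ih =>
          exact ((hr n).resolve_right
            (not_adj_of_notMem_verts hM hmax (hin n) (hin (n + 1)))).trans ih
      obtain ⟨n, hn, -⟩ := Walk.mem_support_iff_exists_getVert.1 (hw (r 0))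
      exact ⟨n, none, .inl (hn.trans (hconst n).symm)⟩

/-- For a finite connected simple graph `G` on `n` vertices: if `G` has a perfect matching
then `c₀(G) ≤ α'(G)`, otherwise `c₀(G) ≤ α'(G) + 1`; moreover `c₀(G) ≤ ⌈n/2⌉`. -/
theorem stmt10 {V : Type} [Fintype V] (G : SimpleGraph V) (hG : G.Connected) :
    ((∃ M : G.Subgraph, M.IsPerfectMatching) → zeroVisCopNumber G ≤ matchingNumber G) ∧
      (¬ (∃ M : G.Subgraph, M.IsPerfectMatching) →
        zeroVisCopNumber G ≤ matchingNumber G + 1) ∧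
      zeroVisCopNumber G ≤ (Fintype.card V + 1) / 2 := by
  refine ⟨?_, fun _ ↦ zeroVisCopNumber_le_matchingNumber_add_one hG, ?_⟩
  · rintro ⟨M, hM⟩
    exact (zeroVisCopNumber_le_of_isPerfectMatching hM).trans (ncard_edgeSet_le_matchingNumber hM.1)
  · obtain ⟨M, hM, hmax⟩ := exists_ncard_edgeSet_eq_matchingNumber G
    have hle := two_mul_ncard_edgeSet_le hM
    rcases hle.eq_or_lt with heq | hlt
    · have := zeroVisCopNumber_le_of_isPerfectMatching
        (IsMatching.isPerfectMatching_of_card hM heq)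
      lia
    · have := zeroVisCopNumber_le_matchingNumber_add_one hG
      lia

end CopsRobber
end

section
/- If T is a finite tree, then c_{H,2}(T) ≤ 2. -/
namespace CopsRobber

open SimpleGraph

section Tree

variable {V : Type} {T : SimpleGraph V}

lemma exists_adj_dist_lt (hT : T.Connected) {r a : V} (h : r ≠ a) :
    ∃ y, T.Adj a y ∧ T.dist r y < T.dist r a := by
  obtain ⟨p, hp⟩ := hT.exists_walk_length_eq_dist a r
  cases p with
  | nil => exact absurd rfl h
  | cons hadj q =>
    refine ⟨_, hadj, ?_⟩
    rw [T.dist_comm, T.dist_comm (u := r), ← hp, Walk.length_cons]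
    exact Nat.lt_succ_of_le (dist_le q)

/-- In a tree, at most one neighbour of `a` is closer to `r` than `a` is. -/
lemma eq_of_adj_of_dist_lt (hT : T.IsTree) {r a y z : V} (hy : T.Adj a y) (hz : T.Adj a z)
    (hyd : T.dist r y < T.dist r a) (hzd : T.dist r z < T.dist r a) : y = z := by
  have key : ∀ w, T.Adj a w → T.dist r w < T.dist r a →
      ∃ p : T.Walk a r, p.IsPath ∧ p.snd = w := by
    intro w hw hwd
    obtain ⟨p, hp⟩ := hT.connected.exists_walk_length_eq_dist w r
    refine ⟨.cons hw p, Walk.isPath_of_length_eq_dist _ ?_, by simp⟩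
    have h := dist_le (Walk.cons hw p)
    have c₁ : T.dist w r = T.dist r w := T.dist_comm
    have c₂ : T.dist a r = T.dist r a := T.dist_comm
    rw [Walk.length_cons] at h ⊢
    omega
  obtain ⟨p, hp, rfl⟩ := key y hy hyd
  obtain ⟨q, hq, rfl⟩ := key z hz hzd
  rw [(hT.existsUnique_path a r).unique hp hq]

lemma dist_lt_of_adj_of_ne (hT : T.IsTree) {r a y z : V} (hy : T.Adj a y) (hz : T.Adj a z)
    (hyd : T.dist r y < T.dist r a) (hne : y ≠ z) : T.dist r a < T.dist r z := by
  have h₁ := hT.dist_ne_of_adj r hz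
  have h₂ : ¬ T.dist r z < T.dist r a := fun h => hne (eq_of_adj_of_dist_lt hT hy hz hyd h)
  omega

/-- A robber cannot leave the side of `y` of the edge `ay` of a tree without stepping on `a`. -/
lemma dist_lt_of_move (hT : T.IsTree) {r r' a y : V} (hy : T.Adj a y)
    (hyd : T.dist r y < T.dist r a) (hmove : r' = r ∨ T.Adj r r') (hne : r' ≠ a) :
    T.dist r' y < T.dist r' a := by
  rcases hmove with rfl | hadj
  · exact hyd
  by_contra hcon
  have e₁ := hT.dist_eq_dist_add_one_of_adj r hy
  have e₂ := hT.dist_eq_dist_add_one_of_adj r' hy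
  have e₃ := hT.dist_eq_dist_add_one_of_adj a hadj
  have e₄ := hT.dist_eq_dist_add_one_of_adj y hadj
  have c₁ : T.dist r y = T.dist y r := T.dist_comm
  have c₂ : T.dist r' y = T.dist y r' := T.dist_comm
  have c₃ : T.dist r a = T.dist a r := T.dist_comm
  have c₄ : T.dist r' a = T.dist a r' := T.dist_comm
  by_cases hry : r = y
  · subst hry
    have h₀ : T.dist r r = 0 := dist_self
    exact hne (hT.connected.dist_eq_zero_iff.1 (by omega))
  · obtain ⟨z, hz, hzd⟩ := exists_adj_dist_lt hT.connected (Ne.symm hry)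
    have e₅ := hT.dist_eq_dist_add_one_of_adj a hz
    have e₆ := hT.dist_eq_dist_add_one_of_adj z hy
    have c₅ : T.dist z y = T.dist y z := T.dist_comm
    have c₆ : T.dist z a = T.dist a z := T.dist_comm
    obtain rfl : z = r' := eq_of_adj_of_dist_lt hT (r := a) hz hadj (by omega) (by omega)
    omega

end Tree

/-- A state of the two cops' search. In `patrol a b L` the cops are at `a` and `b` and the robber
is in a branch at `a` through a vertex of `L`; in `probe a b x L` they are at `x` and `a`, having
moved there from `a` and `b` to look at the neighbour `x` of `a`. -/
inductive SearchState (V : Type)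
  | patrol (a b : V) (L : List V)
  | probe (a b x : V) (L : List V)

namespace SearchState

variable {V : Type} {T : SimpleGraph V}

/-- The cops' positions in a search state. -/
def pos : SearchState V → Fin 2 → V
  | patrol a b _ => ![a, b]
  | probe a _ x _ => ![x, a]

open Classical in
/-- A neighbour of `a` closer to `r` than `a`, if there is one. -/
noncomputable def toward (T : SimpleGraph V) (a r : V) : V :=
  if h : ∃ y, T.Adj a y ∧ T.dist r y < T.dist r a then h.choose else a

/-- The robber at `r` is in a branch at `a` avoiding `b`, through a vertex of `L`. -/
structure Confined (T : SimpleGraph V) (a b : V) (L : List V) (r : V) : Prop where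
  adj : T.Adj a b
  adj_of_mem : ∀ x ∈ L, T.Adj a x
  exists_mem : ∃ y ∈ L, y ≠ b ∧ T.dist r y < T.dist r a

lemma Confined.move (hT : T.IsTree) {a b r r' : V} {L : List V} (h : Confined T a b L r)
    (hmove : r' = r ∨ T.Adj r r') (hne : r' ≠ a) : Confined T a b L r' := by
  obtain ⟨y, hy, hyb, hyd⟩ := h.exists_mem
  exact ⟨h.adj, h.adj_of_mem, y, hy, hyb,
    dist_lt_of_move hT (h.adj_of_mem y hy) hyd hmove hne⟩

/-- A robber invisible to the cops patrolling `a` and `b` is on a vertex of `L`. -/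
lemma Confined.mem_of_invisible (hT : T.IsTree) {a b r : V} {L : List V} (h : Confined T a b L r)
    (ha : 1 ≤ T.dist r a) (hb : T.dist r b ≤ 2) : r ∈ L ∧ r ≠ b ∧ T.Adj a r := by
  obtain ⟨y, hy, hyb, hyd⟩ := h.exists_mem
  have hay := h.adj_of_mem y hy
  have h₁ := dist_lt_of_adj_of_ne hT hay h.adj hyd hyb
  obtain rfl := hT.connected.dist_eq_zero_iff.1 (show T.dist r y = 0 by omega)
  exact ⟨hy, hyb, hay⟩

/-- The visibility predicate of the 2-hyperopic game. -/
def Visible (T : SimpleGraph V) {d : ℕ} (c : Fin d → V) (r : V) : Prop :=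
  ¬ ∀ i, 1 ≤ T.dist r (c i) ∧ T.dist r (c i) ≤ 2

lemma observe_eq_some {d : ℕ} {c : Fin d → V} {r r₀ : V}
    (h : observe (Visible T) c r = some r₀) : r₀ = r := by
  unfold observe at h
  split_ifs at h
  exact (Option.some.inj h).symm

lemma invisible_of_observe_eq_none {d : ℕ} {c : Fin d → V} {r : V}
    (h : observe (Visible T) c r = none) (i : Fin d) :
    1 ≤ T.dist r (c i) ∧ T.dist r (c i) ≤ 2 := by
  unfold observe at h
  split_ifs at h with hv
  exact not_not.1 hv i

lemma toward_eq (hT : T.IsTree) {a r y : V} (hy : T.Adj a y) (hyd : T.dist r y < T.dist r a) :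
    toward T a r = y := by
  have h : ∃ y, T.Adj a y ∧ T.dist r y < T.dist r a := ⟨y, hy, hyd⟩
  rw [toward, dif_pos h]
  exact eq_of_adj_of_dist_lt hT h.choose_spec.1 hy h.choose_spec.2 hyd

variable [Fintype V]

open Classical in
/-- The list of neighbours of a vertex. -/
noncomputable def nbrs (T : SimpleGraph V) (a : V) : List V :=
  (Finset.univ.filter (T.Adj a)).toList

@[simp] lemma mem_nbrs {a x : V} : x ∈ nbrs T a ↔ T.Adj a x := by
  simp [nbrs]

/-- The transition of the search: follow a visible robber, and otherwise look at the next
unexplored neighbour. -/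
noncomputable def step (T : SimpleGraph V) : SearchState V → Option V → SearchState V
  | patrol a _ _, some r => patrol (toward T a r) a (nbrs T (toward T a r))
  | patrol a b [], none => patrol a b []
  | patrol a b (x :: L), none => probe a b x L
  | probe a b _ L, _ => patrol a b L

/-- What the cops know about the position of the robber in a search state. -/
def Inv (T : SimpleGraph V) : SearchState V → V → Prop
  | patrol a b L, r => Confined T a b L r
  | probe a b x L, r => T.Adj a x ∧ Confined T a b L r

open Classical in
/-- The size of the part of the tree in which the robber is confined, and the amount of work left
before the cops can shrink it. -/
noncomputable def rank (T : SimpleGraph V) : SearchState V → ℕ ×ₗ ℕ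
  | patrol a b L => toLex ((Finset.univ.filter fun v => T.dist v a < T.dist v b).card, 2 * L.length)
  | probe a b _ L =>
    toLex ((Finset.univ.filter fun v => T.dist v a < T.dist v b).card, 2 * L.length + 1)

/-- The search moves the cops along edges. -/
lemma adj_pos_step (hT : T.IsTree) {s : SearchState V} {r : V} (h : Inv T s r) (i : Fin 2) :
    (s.step T (observe (Visible T) s.pos r)).pos i = s.pos i ∨
      T.Adj (s.pos i) ((s.step T (observe (Visible T) s.pos r)).pos i) := by
  rcases s with ⟨a, b, L⟩ | ⟨a, b, x, L⟩
  · change Confined T a b L r at h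
    rcases ho : observe (Visible T) (patrol a b L).pos r with _ | r₀
    · rcases L with _ | ⟨x, L⟩
      · exact .inl rfl
      · fin_cases i
        · exact .inr (h.adj_of_mem x (by simp))
        · exact .inr h.adj.symm
    · obtain rfl := observe_eq_some ho
      obtain ⟨y, hy, hyb, hyd⟩ := h.exists_mem
      have hay := h.adj_of_mem y hy
      fin_cases i
      · exact .inr (by simpa [step, pos, toward_eq hT hay hyd] using hay)
      · exact .inr h.adj.symm
  · obtain ⟨hax, h⟩ := h
    fin_cases i
    · exact .inr hax.symm
    · exact .inr h.adj

lemma inv_step (hT : T.IsTree) {s : SearchState V} {r r' : V} (h : Inv T s r)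
    (hmove : r' = r ∨ T.Adj r r')
    (hr : ∀ i, (s.step T (observe (Visible T) s.pos r)).pos i ≠ r)
    (hr' : ∀ i, (s.step T (observe (Visible T) s.pos r)).pos i ≠ r') :
    Inv T (s.step T (observe (Visible T) s.pos r)) r' ∧
      (s.step T (observe (Visible T) s.pos r)).rank T < s.rank T := by
  rcases s with ⟨a, b, L⟩ | ⟨a, b, x, L⟩
  · change Confined T a b L r at h
    rcases ho : observe (Visible T) (patrol a b L).pos r with _ | r₀
    · rw [ho] at hr hr'
      obtain ⟨hrL, hrb, har⟩ := h.mem_of_invisible hT (invisible_of_observe_eq_none ho 0).1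
        (invisible_of_observe_eq_none ho 1).2
      rcases L with _ | ⟨x, L⟩
      · simp at hrL
      · have hrx : r ≠ x := (hr 0).symm
        have hc : Confined T a b L r :=
          ⟨h.adj, fun z hz => h.adj_of_mem z (by simp [hz]), r, by simpa [hrx] using hrL, hrb,
            by simpa using hT.connected.pos_dist_of_ne har.ne'⟩
        refine ⟨⟨h.adj_of_mem x (by simp), hc.move hT hmove (hr' 1).symm⟩, ?_⟩
        simp only [step, rank, Prod.Lex.toLex_lt_toLex, List.length_cons]
        exact .inr ⟨trivial, by omega⟩
    · rw [ho] at hr hr'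
      obtain rfl := observe_eq_some ho
      obtain ⟨y, hy, hyb, hyd⟩ := h.exists_mem
      have hay := h.adj_of_mem y hy
      simp only [step, toward_eq hT hay hyd] at hr hr' ⊢
      have hya : T.dist r' y < T.dist r' a := dist_lt_of_move hT hay hyd hmove (hr' 1).symm
      obtain ⟨z, hz, hzd⟩ := exists_adj_dist_lt hT.connected (hr' 0).symm
      refine ⟨⟨hay.symm, by simp, z, mem_nbrs.2 hz, ?_, hzd⟩, ?_⟩
      · rintro rfl
        exact lt_asymm hya hzd
      · simp only [rank, Prod.Lex.toLex_lt_toLex]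
        refine .inl (Finset.card_lt_card ((Finset.ssubset_iff_of_subset ?_).2 ⟨a, ?_, ?_⟩))
        · intro v hv
          simp only [Finset.mem_filter, Finset.mem_univ, true_and] at hv ⊢
          exact dist_lt_of_adj_of_ne hT hay h.adj hv hyb
        · simpa using hT.connected.pos_dist_of_ne h.adj.ne
        · simp
  · obtain ⟨-, h⟩ := h
    refine ⟨h.move hT hmove (hr' 0).symm, ?_⟩
    simp only [step, rank, Prod.Lex.toLex_lt_toLex]
    exact .inr ⟨trivial, by omega⟩

/-- The search state reached from `s` after a list of observations (most recent first). -/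
noncomputable def run (T : SimpleGraph V) (s : SearchState V) : List (Option V) → SearchState V
  | [] => s
  | o :: h => (run T s h).step T o

open Classical in
/-- The cop strategy following the search started in `s`. -/
noncomputable def strategy (T : SimpleGraph V) (s : SearchState V) : CopStrategy V 2 where
  init := s.pos
  move h p i := if T.Adj (p i) ((run T s h).pos i) then (run T s h).pos i else p i

lemma strategy_legal (s : SearchState V) : (strategy T s).Legal T := by
  intro h p i
  simp only [strategy]
  split_ifs with hadj
  · exact .inr hadj
  · exact .inl rfl

lemma strategy_move (s : SearchState V) (h : List (Option V)) (p : Fin 2 → V)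
    (hp : ∀ i, (run T s h).pos i = p i ∨ T.Adj (p i) ((run T s h).pos i)) :
    (strategy T s).move h p = (run T s h).pos := by
  funext i
  simp only [strategy]
  split_ifs with hadj
  · rfl
  · exact ((hp i).resolve_right hadj).symm

lemma captures_strategy (hT : T.IsTree) (s : SearchState V)
    (hs : ∀ r, (∀ i, s.pos i ≠ r) → Inv T s r)
    (R : RobberStrategy V 2) (hR : R.Legal T) : Captures (Visible T) (strategy T s) R := by
  by_contra hcap
  simp only [Captures, not_exists, not_or] at hcap
  let st : ℕ → SearchState V := fun n =>
    run T s (play (Visible T) (strategy T s) R n).2.1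
  have hst : ∀ n, copPos (Visible T) (strategy T s) R n = (st n).pos →
      st (n + 1) = (st n).step T
        (observe (Visible T) (st n).pos (robPos (Visible T) (strategy T s) R n)) := by
    intro n hn
    rw [← hn]
    rfl
  have hcop : ∀ n, copPos (Visible T) (strategy T s) R n = (st n).pos →
      Inv T (st n) (robPos (Visible T) (strategy T s) R n) →
      copPos (Visible T) (strategy T s) R (n + 1) = (st (n + 1)).pos := by
    intro n hn hinv
    refine strategy_move s _ _ fun i => ?_
    change (st (n + 1)).pos i = copPos (Visible T) (strategy T s) R n i ∨
      T.Adj (copPos (Visible T) (strategy T s) R n i) ((st (n + 1)).pos i)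
    rw [hst n hn, hn]
    exact adj_pos_step hT hinv i
  have hstep : ∀ n, copPos (Visible T) (strategy T s) R n = (st n).pos →
      Inv T (st n) (robPos (Visible T) (strategy T s) R n) →
      Inv T (st (n + 1)) (robPos (Visible T) (strategy T s) R (n + 1)) ∧
        (st (n + 1)).rank T < (st n).rank T := by
    intro n hn hinv
    have hc := hcop n hn hinv
    have h₁ : ∀ i, (st (n + 1)).pos i ≠ robPos (Visible T) (strategy T s) R n :=
      fun i => hc ▸ (hcap n i).2
    have h₂ : ∀ i, (st (n + 1)).pos i ≠ robPos (Visible T) (strategy T s) R (n + 1) :=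
      fun i => hc ▸ (hcap (n + 1) i).1
    rw [hst n hn] at h₁ h₂ ⊢
    exact inv_step hT hinv (hR _ _ _) h₁ h₂
  have hinv : ∀ n, copPos (Visible T) (strategy T s) R n = (st n).pos ∧
      Inv T (st n) (robPos (Visible T) (strategy T s) R n) := by
    intro n
    induction n with
    | zero => exact ⟨rfl, hs _ fun i => (hcap 0 i).1⟩
    | succ n ih => exact ⟨hcop n ih.1 ih.2, (hstep n ih.1 ih.2).1⟩
  obtain ⟨n, hn⟩ := WellFounded.not_rel_apply_succ (r := (· < ·)) fun n => (st n).rank T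
  exact hn (hstep n (hinv n).1 (hinv n).2).2

/-- Starting at a leaf and its neighbour confines the robber. -/
lemma exists_start (hT : T.IsTree) :
    ∃ s : SearchState V, ∀ r, (∀ i, s.pos i ≠ r) → Inv T s r := by
  classical
  rcases subsingleton_or_nontrivial V with hV | hV
  · obtain ⟨v⟩ := hT.connected.nonempty
    exact ⟨patrol v v [], fun r h => (h 0 (Subsingleton.elim _ _)).elim⟩
  · obtain ⟨b, hb⟩ := hT.exists_vert_degree_one_of_nontrivial
    obtain ⟨a, hba, huniq⟩ := degree_eq_one_iff_existsUnique_adj.1 hb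
    refine ⟨patrol a b (nbrs T a), fun r hr => ?_⟩
    obtain ⟨y, hy, hyd⟩ := exists_adj_dist_lt hT.connected (hr 0).symm
    refine ⟨hba.symm, by simp, y, mem_nbrs.2 hy, ?_, hyd⟩
    rintro rfl
    obtain ⟨z, hz, hzd⟩ := exists_adj_dist_lt hT.connected (hr 1).symm
    obtain rfl := huniq z hz
    exact lt_asymm hzd hyd

end SearchState

/-- If `T` is a finite tree, then `c_{H,2}(T) ≤ 2`. -/
theorem stmt12 {V : Type} [Fintype V] (T : SimpleGraph V) (hT : T.IsTree) :
    hyperopicCopNumber T 2 ≤ 2 := by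
  obtain ⟨s, hs⟩ := SearchState.exists_start hT
  exact Nat.sInf_le ⟨SearchState.strategy T s, SearchState.strategy_legal s,
    SearchState.captures_strategy hT s hs⟩

end CopsRobber
end

section
/- Let k ≥ 2 be an integer and let T be a finite tree containing a pendant path on k−1 vertices, i.e., vertices v_1, …, v_{k−1} such that v_i is adjacent to v_{i+1} for 1 ≤ i ≤ k−2, the vertex v_{k−1} has degree 1 in T, and each of v_1, …, v_{k−2} has degree 2 in T. Then c_{H,k}(T) ≤ 2. -/
namespace CopsRobber

open SimpleGraph

section Tree

variable {V : Type} {T : SimpleGraph V}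

/-- A vertex different from the root `ℓ` of a connected graph has a neighbour closer to `ℓ`. -/
lemma exists_parent (hT : T.Connected) (ℓ : V) {r : V} (h : r ≠ ℓ) :
    ∃ q, T.Adj q r ∧ T.dist ℓ r = T.dist ℓ q + 1 := by
  obtain ⟨w, hw⟩ := hT.exists_walk_length_eq_dist r ℓ
  cases w with
  | nil => exact absurd rfl h
  | @cons _ q _ hadj w =>
    refine ⟨q, hadj.symm, ?_⟩
    have h1 := dist_le w
    have h2 := hT.dist_triangle (u := r) (v := q) (w := ℓ)
    rw [dist_eq_one_iff_adj.2 hadj] at h2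
    rw [Walk.length_cons] at hw
    rw [dist_comm (u := ℓ), dist_comm (u := ℓ)]
    omega

/-- In a tree rooted at `ℓ`, every vertex has at most one parent. -/
lemma parent_unique (hT : T.IsTree) {ℓ r a b : V} (ha : T.Adj a r) (hb : T.Adj b r)
    (hda : T.dist ℓ r = T.dist ℓ a + 1) (hdb : T.dist ℓ r = T.dist ℓ b + 1) : a = b := by
  obtain ⟨p, hp⟩ := hT.connected.exists_walk_length_eq_dist ℓ a
  obtain ⟨q, hq⟩ := hT.connected.exists_walk_length_eq_dist ℓ b
  have h1 : (p.concat ha).IsPath :=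
    Walk.isPath_of_length_eq_dist _ (by rw [Walk.length_concat]; omega)
  have h2 : (q.concat hb).IsPath :=
    Walk.isPath_of_length_eq_dist _ (by rw [Walk.length_concat]; omega)
  have h := congrArg Walk.penultimate ((hT.existsUnique_path ℓ r).unique h1 h2)
  simpa using h

/-- The descendants of `c` (including `c`) when the graph is rooted at `ℓ`. -/
def descendants (T : SimpleGraph V) (ℓ c : V) : Set V :=
  {r | T.dist ℓ r = T.dist ℓ c + T.dist c r}

/-- `c'` is a child of `c` when the graph is rooted at `ℓ`. -/
def IsChild (T : SimpleGraph V) (ℓ c c' : V) : Prop :=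
  T.Adj c c' ∧ T.dist ℓ c' = T.dist ℓ c + 1

lemma self_mem_descendants (ℓ c : V) : c ∈ descendants T ℓ c := by
  simp [descendants]

lemma descendants_root (ℓ : V) : descendants T ℓ ℓ = Set.univ := by
  ext r; simp [descendants]

lemma dist_lt_of_mem_descendants (hT : T.Connected) {ℓ c r : V} (h : r ∈ descendants T ℓ c)
    (hne : r ≠ c) : T.dist ℓ c < T.dist ℓ r := by
  have := hT.pos_dist_of_ne hne.symm
  have h : T.dist ℓ r = T.dist ℓ c + T.dist c r := h
  omega

lemma exists_child_of_mem_descendants (hT : T.Connected) {ℓ c r : V}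
    (h : r ∈ descendants T ℓ c) (hne : r ≠ c) :
    ∃ c', IsChild T ℓ c c' ∧ r ∈ descendants T ℓ c' := by
  obtain ⟨c', hadj, hd⟩ := exists_parent hT r hne.symm
  have h1 := hT.dist_triangle (u := ℓ) (v := c') (w := r)
  have h2 := hT.dist_triangle (u := ℓ) (v := c) (w := c')
  have h3 := dist_eq_one_iff_adj.2 hadj.symm
  have h : T.dist ℓ r = T.dist ℓ c + T.dist c r := h
  rw [dist_comm (u := r), dist_comm (u := r)] at hd
  refine ⟨c', ⟨hadj.symm, ?_⟩, ?_⟩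
  · omega
  · show T.dist ℓ r = T.dist ℓ c' + T.dist c' r
    omega

/-- An edge leaving a strict descendant of `c` stays among the descendants of `c`. -/
lemma mem_descendants_of_adj (hT : T.IsTree) {ℓ c r r' : V} (h : r ∈ descendants T ℓ c)
    (hne : r ≠ c) (hadj : T.Adj r r') : r' ∈ descendants T ℓ c := by
  have hc := hT.connected
  have h' : T.dist ℓ r = T.dist ℓ c + T.dist c r := h
  have h1 := hc.dist_triangle (u := ℓ) (v := c) (w := r')
  have h2 := hc.dist_triangle (u := c) (v := r) (w := r')
  rw [dist_eq_one_iff_adj.2 hadj] at h2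
  rcases hT.dist_eq_dist_add_one_of_adj ℓ hadj with hd | hd
  · obtain ⟨q, hq, hdq⟩ := exists_parent hc c hne
    have h3 := hc.dist_triangle (u := ℓ) (v := c) (w := q)
    have h4 := hc.dist_triangle (u := ℓ) (v := q) (w := r)
    rw [dist_eq_one_iff_adj.2 hq] at h4
    have h5 : T.dist ℓ r = T.dist ℓ q + 1 := by omega
    obtain rfl := parent_unique hT hq hadj.symm h5 hd
    show T.dist ℓ q = T.dist ℓ c + T.dist c q
    omega
  · show T.dist ℓ r' = T.dist ℓ c + T.dist c r'
    omega

lemma mem_descendants_of_step (hT : T.IsTree) {ℓ c r r' : V} (h : r ∈ descendants T ℓ c)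
    (hne : r ≠ c) (hstep : r' = r ∨ T.Adj r r') : r' ∈ descendants T ℓ c := by
  rcases hstep with rfl | hadj
  · exact h
  · exact mem_descendants_of_adj hT h hne hadj

/-- A non-root vertex of degree at most two has at most one child. -/
lemma child_unique_of_ncard_le_two [Finite V] (hT : T.Connected) {ℓ c a b : V} (hc : c ≠ ℓ)
    (hdeg : (T.neighborSet c).ncard ≤ 2) (ha : IsChild T ℓ c a) (hb : IsChild T ℓ c b) :
    a = b := by
  obtain ⟨q, hq, hdq⟩ := exists_parent hT ℓ hc
  by_contra hab
  have hqa : q ≠ a := by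
    rintro rfl
    have := ha.2
    omega
  have hqb : q ≠ b := by
    rintro rfl
    have := hb.2
    omega
  have hsub : ({q, a, b} : Set V) ⊆ T.neighborSet c := by
    rintro x (rfl | rfl | rfl)
    · exact hq.symm
    · exact ha.1
    · exact hb.1
  have h3 : ({q, a, b} : Set V).ncard = 3 := Set.ncard_eq_three.2 ⟨q, a, b, hqa, hqb, hab, rfl⟩
  have := Set.ncard_le_ncard hsub (Set.toFinite _)
  omega

/-- The vertices of a pendant path on `k - 1` vertices have at most one child when the tree is
rooted at the end `ℓ` of the path. -/
lemma child_unique_of_pendant [Finite V] (hT : T.IsTree) (k : ℕ) (hk : 2 ≤ k)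
    (p : Fin (k - 1) → V) (hinj : Function.Injective p)
    (hadj : ∀ (j : ℕ) (h' : j < k - 1) (h : j + 1 < k - 1), T.Adj (p ⟨j, h'⟩) (p ⟨j + 1, h⟩))
    {ℓ : V} (hlast : k - 2 < k - 1) (hℓ : ℓ = p ⟨k - 2, hlast⟩)
    (hleaf : (T.neighborSet ℓ).ncard = 1)
    (hdeg2 : ∀ (j : ℕ) (h' : j < k - 1), j < k - 2 → (T.neighborSet (p ⟨j, h'⟩)).ncard = 2)
    {c a b : V} (hc : T.dist ℓ c < k - 1) (ha : IsChild T ℓ c a) (hb : IsChild T ℓ c b) :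
    a = b := by
  have huniq : ∀ (j : ℕ) (h : j < k - 1) (c a b : V), c = p ⟨j, h⟩ → IsChild T ℓ c a →
      IsChild T ℓ c b → a = b := by
    rintro j h _ a b rfl ha hb
    by_cases hj : j < k - 2
    · refine child_unique_of_ncard_le_two hT.connected ?_ (hdeg2 j h hj).le ha hb
      intro he
      have := congrArg Fin.val (hinj (he.trans hℓ))
      simp only at this
      omega
    · obtain rfl : j = k - 2 := by omega
      obtain ⟨x, hx⟩ := Set.ncard_eq_one.1 hleaf
      have h1 : a ∈ T.neighborSet ℓ := hℓ ▸ ha.1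
      have h2 : b ∈ T.neighborSet ℓ := hℓ ▸ hb.1
      rw [hx] at h1 h2
      exact h1.trans h2.symm
  have hpos : ∀ (i : ℕ) (hi : i < k - 1) (x : V), T.dist ℓ x = i →
      x = p ⟨k - 2 - i, by omega⟩ := by
    intro i
    induction i using Nat.strong_induction_on with
    | _ i ih =>
      intro hi x hx
      obtain rfl | ⟨i, rfl⟩ : i = 0 ∨ ∃ m, i = m + 1 := by
        cases i <;> simp
      · exact (hT.connected.dist_eq_zero_iff.1 hx).symm.trans hℓ
      · have hxne : x ≠ ℓ := by rintro rfl; simp at hx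
        obtain ⟨y, hyx, hdy⟩ := exists_parent hT.connected ℓ hxne
        have hy := ih i (by omega) (by omega) y (by omega)
        have hz : T.Adj (p ⟨k - 2 - (i + 1), by omega⟩) y := by
          have hlt : k - 2 - (i + 1) + 1 < k - 1 := by omega
          have hy' : p ⟨k - 2 - (i + 1) + 1, hlt⟩ = y :=
            (congrArg p (Fin.ext (by simp only; omega))).trans hy.symm
          have hj := hadj (k - 2 - (i + 1)) (by omega) hlt
          rwa [hy'] at hj
        refine huniq (k - 2 - i) (by omega) y _ _ hy ⟨hyx, hdy⟩ ⟨hz.symm, ?_⟩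
        rcases hT.dist_eq_dist_add_one_of_adj ℓ hz with hd | hd
        · exact hd
        · have := ih (T.dist ℓ (p ⟨k - 2 - (i + 1), by omega⟩)) (by omega) (by omega) _ rfl
          have := congrArg Fin.val (hinj this)
          simp only at this
          omega
  exact huniq _ _ c a b (hpos _ hc c rfl) ha hb

end Tree

section Search

variable {V : Type} {G : SimpleGraph V} {vis : (Fin 2 → V) → V → Prop} {ℓ : V}

/-- The possible robber positions after a round in which the first cop stays at `ℓ`, the second
one moves from `c` to `c'` after observing `o`, the robber was known to be in `S`, and no capture
takes place. -/
def nextSet (G : SimpleGraph V) (vis : (Fin 2 → V) → V → Prop) (ℓ c : V) (S : Set V)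
    (o : Option V) (c' : V) : Set V :=
  {r' | ∃ r ∈ S, observe vis ![ℓ, c] r = o ∧ r ≠ c' ∧ (r' = r ∨ G.Adj r r') ∧ r' ≠ c'}

/-- With the first cop staying at `ℓ`, the second cop at `c` can force a capture within `n` rounds
if the robber is known to be in `S`. -/
def WinsIn (G : SimpleGraph V) (vis : (Fin 2 → V) → V → Prop) (ℓ : V) : ℕ → V → Set V → Prop
  | 0, _, S => S = ∅
  | n + 1, c, S => ∀ o, ∃ c', (c' = c ∨ G.Adj c c') ∧ WinsIn G vis ℓ n c' (nextSet G vis ℓ c S o c')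

/-- With the first cop staying at `ℓ`, the second cop at `c` can force a capture if the robber is
known to be in `S`. -/
def Wins (G : SimpleGraph V) (vis : (Fin 2 → V) → V → Prop) (ℓ c : V) (S : Set V) : Prop :=
  ∃ n, WinsIn G vis ℓ n c S

lemma nextSet_mono {c c' : V} {S S' : Set V} {o : Option V} (h : S' ⊆ S) :
    nextSet G vis ℓ c S' o c' ⊆ nextSet G vis ℓ c S o c' :=
  fun _ ⟨r, hr, h'⟩ => ⟨r, h hr, h'⟩

lemma WinsIn.mono {n : ℕ} {c : V} {S S' : Set V} (hw : WinsIn G vis ℓ n c S) (h : S' ⊆ S) :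
    WinsIn G vis ℓ n c S' := by
  induction n generalizing c S S' with
  | zero => exact Set.subset_eq_empty h hw
  | succ n ih =>
    intro o
    obtain ⟨c', hc, hw'⟩ := hw o
    exact ⟨c', hc, ih hw' (nextSet_mono h)⟩

lemma WinsIn.succ {n : ℕ} {c : V} {S : Set V} (hw : WinsIn G vis ℓ n c S) :
    WinsIn G vis ℓ (n + 1) c S := by
  induction n generalizing c S with
  | zero =>
    obtain rfl : S = ∅ := hw
    intro o
    refine ⟨c, Or.inl rfl, ?_⟩
    show nextSet G vis ℓ c ∅ o c = ∅
    simp [nextSet]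
  | succ n ih =>
    intro o
    obtain ⟨c', hc, hw'⟩ := hw o
    exact ⟨c', hc, ih hw'⟩

lemma WinsIn.of_le {m n : ℕ} (hmn : m ≤ n) {c : V} {S : Set V} (hw : WinsIn G vis ℓ m c S) :
    WinsIn G vis ℓ n c S := by
  induction hmn with
  | refl => exact hw
  | step _ ih => exact ih.succ

lemma Wins.mono {c : V} {S S' : Set V} (hw : Wins G vis ℓ c S) (h : S' ⊆ S) :
    Wins G vis ℓ c S' :=
  hw.imp fun _ hn => hn.mono h

lemma wins_empty (c : V) : Wins G vis ℓ c ∅ := ⟨0, rfl⟩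

lemma Wins.step [Finite V] {c : V} {S : Set V}
    (h : ∀ o, ∃ c', (c' = c ∨ G.Adj c c') ∧ Wins G vis ℓ c' (nextSet G vis ℓ c S o c')) :
    Wins G vis ℓ c S := by
  choose f hf n hn using h
  obtain ⟨N, hN⟩ := (Set.finite_range n).bddAbove
  exact ⟨N + 1, fun o => ⟨f o, hf o, (hn o).of_le (hN ⟨o, rfl⟩)⟩⟩

/-- The position of the second cop and the possible robber positions after the given observations,
when the second cop's moves are given by `F`, which also receives the number of remaining rounds. -/
def track (G : SimpleGraph V) (vis : (Fin 2 → V) → V → Prop) (ℓ : V)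
    (F : ℕ → V → Set V → Option V → V) (N : ℕ) (c₀ : V) (S₀ : Set V) : List (Option V) → V × Set V
  | [] => (c₀, S₀)
  | o :: h =>
    let s := track G vis ℓ F N c₀ S₀ h
    let c' := F (N - (h.length + 1)) s.1 s.2 o
    (c', nextSet G vis ℓ s.1 s.2 o c')

open Classical in
/-- A knowledge-based win for the second cop yields a winning strategy for two cops. -/
lemma Wins.exists_strategy {c₀ : V} (hw : Wins G vis ℓ c₀ {r | r ≠ c₀}) :
    ∃ S : CopStrategy V 2, WinningCopStrategy G vis S := by
  obtain ⟨N, hN⟩ := hw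
  have hF : ∀ (n : ℕ) (c : V) (S : Set V) (o : Option V), ∃ c', WinsIn G vis ℓ (n + 1) c S →
      (c' = c ∨ G.Adj c c') ∧ WinsIn G vis ℓ n c' (nextSet G vis ℓ c S o c') := by
    intro n c S o
    by_cases h : WinsIn G vis ℓ (n + 1) c S
    · exact (h o).imp fun _ hc _ => hc
    · exact ⟨c, fun h' => absurd h' h⟩
  choose F hF using hF
  let tr := track G vis ℓ F N c₀ {r | r ≠ c₀}
  let S : CopStrategy V 2 :=
    { init := ![ℓ, c₀]
      move := fun h q i =>
        if ![ℓ, (tr h).1] i = q i ∨ G.Adj (q i) (![ℓ, (tr h).1] i) then ![ℓ, (tr h).1] i else q i }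
  refine ⟨S, ?_, ?_⟩
  · intro h q i
    simp only [S]
    split_ifs with hq
    · exact hq
    · exact Or.inl rfl
  intro R hR
  by_contra hcap
  have hcap : ∀ n i, copPos vis S R n i ≠ robPos vis S R n ∧
      copPos vis S R (n + 1) i ≠ robPos vis S R n := by
    intro n i
    constructor
    · intro h; exact hcap ⟨n, i, Or.inl h⟩
    · intro h; exact hcap ⟨n, i, Or.inr h⟩
  have main : ∀ n ≤ N, (play vis S R n).2.1.length = n ∧
      copPos vis S R n = ![ℓ, (tr (play vis S R n).2.1).1] ∧
      robPos vis S R n ∈ (tr (play vis S R n).2.1).2 ∧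
      WinsIn G vis ℓ (N - n) (tr (play vis S R n).2.1).1 (tr (play vis S R n).2.1).2 := by
    intro n
    induction n with
    | zero => exact fun _ => ⟨rfl, rfl, fun h => (hcap 0 1).1 h.symm, hN⟩
    | succ n ih =>
      intro hn
      obtain ⟨hlen, hcop, hrob, hwin⟩ := ih (by omega)
      set h := (play vis S R n).2.1 with hh
      set o := observe vis (copPos vis S R n) (robPos vis S R n) with ho
      have hhist : (play vis S R (n + 1)).2.1 = o :: h := rfl
      have hm : N - n = N - (h.length + 1) + 1 := by omega
      rw [hm] at hwin
      obtain ⟨hleg, hwin'⟩ := hF _ _ _ o hwin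
      have hcop' : copPos vis S R (n + 1) = ![ℓ, (tr (o :: h)).1] := by
        have : copPos vis S R (n + 1) = S.move (o :: h) (copPos vis S R n) := rfl
        rw [this, hcop]
        funext i
        simp only [S]
        refine if_pos ?_
        fin_cases i
        · exact Or.inl rfl
        · exact hleg
      rw [hhist]
      refine ⟨by simp [hlen], hcop', ?_, ?_⟩
      · refine ⟨_, hrob, ?_, ?_, hR _ _ _, ?_⟩
        · rw [← hcop]
        · have := (hcap n 1).2
          rw [hcop'] at this
          exact this.symm
        · have := (hcap (n + 1) 1).1
          rw [hcop'] at this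
          exact this.symm
      · have hm' : N - (n + 1) = N - (h.length + 1) := by omega
        rw [hm']
        exact hwin'
  obtain ⟨-, -, hrob, hwin⟩ := main N le_rfl
  rw [Nat.sub_self] at hwin
  have hwin : (tr (play vis S R N).2.1).2 = ∅ := hwin
  rw [hwin] at hrob
  exact hrob

lemma eq_of_observe_eq_some {c : Fin 2 → V} {r s : V} (h : observe vis c r = some s) : r = s := by
  unfold observe at h
  split_ifs at h
  exact Option.some.inj h

end Search

section Hyperopic

variable {V : Type} [Finite V] {T : SimpleGraph V} {ℓ : V} {k : ℕ}
  {vis : (Fin 2 → V) → V → Prop}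

/-- If the robber is visible whenever he is far from `ℓ`, a cop at depth at least `k` catches a
robber among his strict descendants. -/
lemma wins_strict_descendants (hT : T.IsTree)
    (hvis : ∀ c r, observe vis ![ℓ, c] r = none → T.dist ℓ r ≤ k)
    (c : V) (hc : k ≤ T.dist ℓ c) : Wins T vis ℓ c (descendants T ℓ c \ {c}) := by
  obtain ⟨B, hB⟩ := (Set.finite_range (T.dist ℓ)).bddAbove
  have hB : ∀ x, T.dist ℓ x ≤ B := fun x => hB ⟨x, rfl⟩
  obtain ⟨m, hm⟩ : ∃ m, B ≤ T.dist ℓ c + m := ⟨B, by omega⟩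
  induction m generalizing c with
  | zero =>
    refine (wins_empty c).mono ?_
    rintro r ⟨hr, hne⟩
    have := dist_lt_of_mem_descendants hT.connected hr hne
    have := hB r
    omega
  | succ m ih =>
    refine Wins.step fun o => ?_
    by_cases hex : ∃ r ∈ descendants T ℓ c \ {c}, o = some r
    · obtain ⟨r, ⟨hr, hne⟩, rfl⟩ := hex
      obtain ⟨c', hchild, hr'⟩ := exists_child_of_mem_descendants hT.connected hr hne
      have := hchild.2
      refine ⟨c', Or.inr hchild.1, (ih c' (by omega) (by omega)).mono ?_⟩
      rintro s ⟨q, -, hobs, hqc, hstep, hs⟩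
      obtain rfl := eq_of_observe_eq_some hobs
      exact ⟨mem_descendants_of_step hT hr' hqc hstep, hs⟩
    · refine ⟨c, Or.inl rfl, (wins_empty c).mono ?_⟩
      rintro s ⟨q, hq, hobs, -⟩
      cases o with
      | none =>
        have h1 := hvis _ _ hobs
        have h2 := dist_lt_of_mem_descendants hT.connected hq.1 hq.2
        omega
      | some r =>
        obtain rfl := eq_of_observe_eq_some hobs
        exact hex ⟨q, hq, rfl⟩

/-- A cop at depth `k - 1` catches a robber below finitely many children by clearing the children
one after the other, returning to his vertex in between. -/
lemma wins_iUnion_children (hT : T.IsTree)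
    (hvis : ∀ c r, observe vis ![ℓ, c] r = none → T.dist ℓ r ≤ k) {v : V}
    (hv : T.dist ℓ v + 1 = k) (U : Finset V) (hU : ∀ w ∈ U, IsChild T ℓ v w) :
    Wins T vis ℓ v (⋃ w ∈ U, descendants T ℓ w) := by
  classical
  induction U using Finset.induction_on with
  | empty => exact (wins_empty v).mono (by simp)
  | insert w₁ U hw₁ ih =>
    have ih := ih fun w hw => hU w (Finset.mem_insert_of_mem hw)
    have hU' : ∀ w ∈ U, IsChild T ℓ v w := fun w hw => hU w (Finset.mem_insert_of_mem hw)
    have hstay : ∀ w r r', IsChild T ℓ v w → r ∈ descendants T ℓ w → (r' = r ∨ T.Adj r r') →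
        r' = v ∨ r' ∈ descendants T ℓ w := by
      intro w r r' hw hr hstep
      by_cases hrw : r = w
      · subst hrw
        rcases hstep with rfl | hadj
        · exact Or.inr hr
        · rcases hT.dist_eq_dist_add_one_of_adj ℓ hadj with hd | hd
          · exact Or.inl (parent_unique hT hadj.symm hw.1 hd hw.2)
          · refine Or.inr ?_
            show T.dist ℓ r' = T.dist ℓ r + T.dist r r'
            rw [dist_eq_one_iff_adj.2 hadj, hd]
      · exact Or.inr (mem_descendants_of_step hT hr hrw hstep)
    have hreturn : Wins T vis ℓ w₁ (insert v (⋃ w ∈ U, descendants T ℓ w)) := by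
      refine Wins.step fun o => ⟨v, Or.inr (hU w₁ (Finset.mem_insert_self _ _)).1.symm, ?_⟩
      refine ih.mono ?_
      rintro s ⟨r, hr, -, hrv, hstep, hsv⟩
      obtain ⟨w, hw, hrw⟩ := Set.mem_iUnion₂.1 (hr.resolve_left hrv)
      exact Set.mem_iUnion₂.2 ⟨w, hw, (hstay w r s (hU' w hw) hrw hstep).resolve_left hsv⟩
    refine Wins.step fun o => ?_
    by_cases hex : ∃ w ∈ insert w₁ U, ∃ r ∈ descendants T ℓ w, o = some r
    · obtain ⟨w, hw, r, hr, rfl⟩ := hex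
      have hchild := hU w hw
      have := hchild.2
      refine ⟨w, Or.inr hchild.1, (wins_strict_descendants hT hvis w (by omega)).mono ?_⟩
      rintro s ⟨q, -, hobs, hqw, hstep, hs⟩
      obtain rfl := eq_of_observe_eq_some hobs
      exact ⟨mem_descendants_of_step hT hr hqw hstep, hs⟩
    · refine ⟨w₁, Or.inr (hU w₁ (Finset.mem_insert_self _ _)).1, hreturn.mono ?_⟩
      rintro s ⟨q, hq, hobs, hqw₁, hstep, hs⟩
      obtain ⟨w, hw, hqw⟩ := Set.mem_iUnion₂.1 hq
      cases o with
      | some r =>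
        obtain rfl := eq_of_observe_eq_some hobs
        exact absurd ⟨w, hw, q, hqw, rfl⟩ hex
      | none =>
        have h1 := hvis _ _ hobs
        have h2 := (hU w hw).2
        obtain rfl : q = w := by
          by_contra hne
          have := dist_lt_of_mem_descendants hT.connected hqw hne
          omega
        have hqU : q ∈ U := (Finset.mem_insert.1 hw).resolve_left hqw₁
        exact (hstay q q s (hU' q hqU) hqw hstep).imp id
          fun h => Set.mem_iUnion₂.2 ⟨q, hqU, h⟩

/-- If the vertices of depth less than `k - 1` have at most one child, a cop starting at the
root `ℓ` wins. -/
lemma wins_from_root (hT : T.IsTree) (hk : 1 ≤ k)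
    (hvis : ∀ c r, observe vis ![ℓ, c] r = none → T.dist ℓ r ≤ k)
    (huniq : ∀ c a b, T.dist ℓ c < k - 1 → IsChild T ℓ c a → IsChild T ℓ c b → a = b) :
    Wins T vis ℓ ℓ {r | r ≠ ℓ} := by
  have key : ∀ m c, T.dist ℓ c + m = k - 1 → Wins T vis ℓ c (descendants T ℓ c \ {c}) := by
    intro m
    induction m with
    | zero =>
      intro c hc
      have hfin : {w | IsChild T ℓ c w}.Finite := Set.toFinite _
      refine (wins_iUnion_children hT hvis (by omega) hfin.toFinset (by simp)).mono ?_
      rintro r ⟨hr, hne⟩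
      obtain ⟨w, hw, hrw⟩ := exists_child_of_mem_descendants hT.connected hr hne
      exact Set.mem_iUnion₂.2 ⟨w, by simpa using hw, hrw⟩
    | succ m ih =>
      intro c hc
      by_cases hex : ∃ w, IsChild T ℓ c w
      · obtain ⟨w, hw⟩ := hex
        have := hw.2
        refine Wins.step fun o => ⟨w, Or.inr hw.1, (ih w (by omega)).mono ?_⟩
        rintro s ⟨q, ⟨hq, hqc⟩, -, hqw, hstep, hs⟩
        obtain ⟨w', hw', hqw'⟩ := exists_child_of_mem_descendants hT.connected hq hqc
        obtain rfl := huniq c w w' (by omega) hw hw'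
        exact ⟨mem_descendants_of_step hT hqw' hqw hstep, hs⟩
      · refine (wins_empty c).mono ?_
        rintro r ⟨hr, hne⟩
        obtain ⟨w, hw, -⟩ := exists_child_of_mem_descendants hT.connected hr hne
        exact hex ⟨w, hw⟩
  refine (key (k - 1) ℓ (by simp)).mono fun r hr => ⟨?_, hr⟩
  rw [descendants_root]
  trivial

end Hyperopic

/-- If `k ≥ 2` and the finite tree `T` contains a pendant path on `k - 1` vertices
`v₁, …, v_{k-1}` (consecutive vertices adjacent, `v_{k-1}` of degree 1 in `T`, and
`v₁, …, v_{k-2}` of degree 2 in `T`), then `c_{H,k}(T) ≤ 2`. -/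
theorem stmt13 {V : Type} [Fintype V] (T : SimpleGraph V) (hT : T.IsTree)
    (k : ℕ) (hk : 2 ≤ k) (p : Fin (k - 1) → V) (hinj : Function.Injective p)
    (hadj : ∀ (j : ℕ) (h : j + 1 < k - 1), T.Adj (p ⟨j, by omega⟩) (p ⟨j + 1, h⟩))
    (hleaf : (T.neighborSet (p ⟨k - 2, by omega⟩)).ncard = 1)
    (hdeg2 : ∀ (j : ℕ) (h : j < k - 2), (T.neighborSet (p ⟨j, by omega⟩)).ncard = 2) :
    hyperopicCopNumber T k ≤ 2 := by
  refine Nat.sInf_le (Wins.exists_strategy (ℓ := p ⟨k - 2, by omega⟩)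
    (wins_from_root (k := k) hT (by omega) ?_ ?_))
  · intro c r h
    unfold observe at h
    split_ifs at h with hv
    rw [not_not] at hv
    rw [dist_comm]
    exact (hv 0).2
  · intro c a b hc ha hb
    exact child_unique_of_pendant hT k hk p hinj (fun j _ h => hadj j h) (by omega) rfl hleaf
      (fun j _ h => hdeg2 j h) hc ha hb

end CopsRobber
end
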